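/- arXiv:math/0610360 — 2 statements merged into one kernel-verified Lean document; each statement's English description precedes it below -/
import Mathlib

section
/- Let σ^(e)(n) denote the sum of exponential divisors of n, where d = ∏_p p^{δ_p} is an exponential divisor of n = ∏_p p^{ν_p} (for n > 1 with the same prime support) if δ_p | ν_p for every prime p, and σ^(e)(1) = 1. Then limsup_{n→∞} σ^(e)(n)/(n·log log n) = (6/π²)·e^γ. -/
open Filter Real

open scoped Topology

theorem log_factorial_eq_sum_primesLE (N : ℕ) :
    log (N.factorial : ℝ) = ∑ p ∈ N.primesLE, (N.factorial.factorization p : ℝ) * log p := by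
  have hN : N.factorial ≠ 0 := N.factorial_ne_zero
  have hsupp : N.factorial.factorization.support ⊆ N.primesLE := by
    intro p hp
    rw [Nat.support_factorization, Nat.mem_primeFactors] at hp
    exact Nat.mem_primesLE.2 ⟨(hp.1.dvd_factorial).1 hp.2.1, hp.1⟩
  conv_lhs => rw [← Nat.prod_factorization_pow_eq_self hN]
  rw [Finsupp.prod_of_support_subset _ hsupp _ (by simp), Nat.cast_prod, Real.log_prod]
  · simp
  · intro p hp
    have := (Nat.prime_of_mem_primesLE hp).pos
    positivity

theorem le_factorization_factorial {p : ℕ} (hp : p.Prime) (N : ℕ) :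
    (N : ℝ) / p - 1 ≤ N.factorial.factorization p := by
  have h : N / p ≤ N.factorial.factorization p := by
    rw [Nat.factorization_factorial hp (b := Nat.log p N + 2) (by omega)]
    simpa using Finset.single_le_sum (f := fun i => N / p ^ i) (fun _ _ => Nat.zero_le _)
      (Finset.mem_Ico.2 ⟨le_refl 1, by omega⟩ : 1 ∈ Finset.Ico 1 (Nat.log p N + 2))
  have h2 : (N : ℝ) / p < (N / p : ℕ) + 1 := by
    rw [← Nat.floor_div_eq_div (K := ℝ)]
    exact Nat.lt_floor_add_one _
  have h3 : ((N / p : ℕ) : ℝ) ≤ N.factorial.factorization p := by exact_mod_cast h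
  linarith

theorem factorization_factorial_le {p : ℕ} (hp : p.Prime) (N : ℕ) :
    (N.factorial.factorization p : ℝ) ≤ N / ((p : ℝ) - 1) := by
  have h1 : (1 : ℝ) < p := by exact_mod_cast hp.one_lt
  rw [le_div_iff₀ (by linarith), mul_comm]
  have h := Nat.sub_one_mul_factorization_factorial (n := N) hp
  have h' : (p - 1) * N.factorial.factorization p ≤ N := by omega
  have h2 : (((p - 1 : ℕ) : ℝ)) * N.factorial.factorization p ≤ N := by exact_mod_cast h'
  rwa [Nat.cast_sub hp.one_le, Nat.cast_one] at h2

theorem log_div_mul_sub_one_le {n : ℕ} (hn : 2 ≤ n) :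
    log n * (1 / ((n : ℝ) - 1) - 1 / n) ≤ 4 * (n : ℝ) ^ (-(3 / 2) : ℝ) := by
  have h2 : (2 : ℝ) ≤ n := by exact_mod_cast hn
  have hl := Real.log_le_rpow_div (x := n) (ε := 1 / 2) (by positivity) (by norm_num)
  have e : 1 / ((n : ℝ) - 1) - 1 / n ≤ 2 * (n : ℝ) ^ (-2 : ℝ) := by
    rw [Real.rpow_neg (by positivity), Real.rpow_two, div_sub_div _ _ (by linarith) (by linarith),
      div_le_iff₀ (by nlinarith), ← div_eq_mul_inv, div_mul_eq_mul_div, le_div_iff₀ (by positivity)]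
    nlinarith
  have e0 : 0 ≤ 1 / ((n : ℝ) - 1) - 1 / n := by
    rw [sub_nonneg]
    exact one_div_le_one_div_of_le (by linarith) (by linarith)
  calc _ ≤ ((n : ℝ) ^ (1 / 2 : ℝ) / (1 / 2)) * (2 * (n : ℝ) ^ (-2 : ℝ)) := by gcongr
    _ = 4 * ((n : ℝ) ^ (1 / 2 : ℝ) * (n : ℝ) ^ (-2 : ℝ)) := by ring
    _ = _ := by rw [← Real.rpow_add (by positivity)]; norm_num

/-- Mertens' first theorem. -/
theorem exists_abs_sum_log_div_sub_log_le :
    ∃ C, ∀ N : ℕ, 1 ≤ N → |∑ p ∈ N.primesLE, log p / p - log N| ≤ C := by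
  have hs : Summable fun n : ℕ => 4 * (n : ℝ) ^ (-(3 / 2) : ℝ) :=
    (Real.summable_nat_rpow.2 (by norm_num)).mul_left 4
  set c := ∑' n : ℕ, 4 * (n : ℝ) ^ (-(3 / 2) : ℝ)
  have hc : 0 ≤ c := tsum_nonneg fun n => by positivity
  have hlog4 : 0 ≤ log 4 := log_nonneg (by norm_num)
  refine ⟨1 + c + log 4, fun N hN => ?_⟩
  have hN0 : (0 : ℝ) < N := by exact_mod_cast hN
  have hlog : ∀ p ∈ N.primesLE, 0 ≤ log (p : ℝ) := fun p _ => Real.log_natCast_nonneg p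
  have hfac := log_factorial_eq_sum_primesLE N
  have hlow : (N : ℝ) * log N - N ≤ log (N.factorial : ℝ) := by
    have h := Stirling.le_log_factorial_stirling (n := N) (by omega)
    have h1 : 0 ≤ log (N : ℝ) := Real.log_natCast_nonneg N
    have h2 : 0 ≤ log (2 * π) := log_nonneg (by linarith [Real.pi_gt_three])
    linarith
  have hup : log (N.factorial : ℝ) ≤ N * log N := by
    rw [← Real.log_pow]
    exact Real.log_le_log (by exact_mod_cast N.factorial_pos)
      (by exact_mod_cast Nat.factorial_le_pow N)
  have htheta : ∑ p ∈ N.primesLE, log (p : ℝ) ≤ log 4 * N := by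
    rw [← Chebyshev.theta_eq_sum_primesLE_log]
    exact Chebyshev.theta_le_log4_mul_x hN0.le
  have hA : N * ∑ p ∈ N.primesLE, log (p : ℝ) / p - log 4 * N ≤ N * log N := by
    have : N * ∑ p ∈ N.primesLE, log (p : ℝ) / p - ∑ p ∈ N.primesLE, log (p : ℝ)
        ≤ log (N.factorial : ℝ) := by
      rw [hfac, Finset.mul_sum, ← Finset.sum_sub_distrib]
      refine Finset.sum_le_sum fun p hp => ?_
      have := mul_le_mul_of_nonneg_right
        (le_factorization_factorial (Nat.prime_of_mem_primesLE hp) N) (hlog p hp)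
      calc _ = ((N : ℝ) / p - 1) * log p := by ring
        _ ≤ _ := this
    linarith
  have hB : N * log N - N ≤ N * ∑ p ∈ N.primesLE, log (p : ℝ) / p + N * c := by
    have h1 : ∑ p ∈ N.primesLE, log p * (1 / ((p : ℝ) - 1) - 1 / p) ≤ c :=
      (Finset.sum_le_sum fun p hp =>
        log_div_mul_sub_one_le (Nat.prime_of_mem_primesLE hp).two_le).trans
        (hs.sum_le_tsum _ fun _ _ => by positivity)
    have h2 : log (N.factorial : ℝ) ≤ N * ∑ p ∈ N.primesLE, log (p : ℝ) / p +
        N * ∑ p ∈ N.primesLE, log p * (1 / ((p : ℝ) - 1) - 1 / p) := by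
      rw [hfac, ← mul_add, ← Finset.sum_add_distrib, Finset.mul_sum]
      refine Finset.sum_le_sum fun p hp => ?_
      have := mul_le_mul_of_nonneg_right
        (factorization_factorial_le (Nat.prime_of_mem_primesLE hp) N) (hlog p hp)
      refine this.trans (le_of_eq ?_)
      ring
    have := mul_le_mul_of_nonneg_left h1 hN0.le
    linarith
  rw [abs_le]
  constructor <;> refine le_of_mul_le_mul_left ?_ hN0 <;> nlinarith

theorem tendsto_of_abs_sub_le_sub {s g : ℕ → ℝ} (hg : Tendsto g atTop (𝓝 0))
    (h : ∀ n, |s (n + 1) - s n| ≤ g n - g (n + 1)) : ∃ L, Tendsto s atTop (𝓝 L) := by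
  have hanti : Antitone fun n => s n + g n := antitone_nat_of_succ_le fun n => by
    linarith [(abs_le.1 (h n)).2]
  have hmono : Monotone fun n => s n - g n := monotone_nat_of_le_succ fun n => by
    linarith [(abs_le.1 (h n)).1]
  have hg0 : ∀ n, 0 ≤ g n := fun n =>
    (antitone_nat_of_succ_le fun n => by linarith [abs_nonneg (s (n + 1) - s n), h n] :
      Antitone g).le_of_tendsto hg n
  have hb : BddBelow (Set.range fun n => s n + g n) := by
    refine ⟨s 0 - g 0, ?_⟩
    rintro _ ⟨n, rfl⟩
    have := hmono (Nat.zero_le n)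
    simp only at this ⊢
    linarith [hg0 n]
  refine ⟨_, (by simpa using (tendsto_atTop_ciInf hanti hb).sub hg)⟩

theorem abs_log_sub_log_sub_le {x y : ℝ} (hy : 0 < y) (hyx : y ≤ x) (hxy : x - y ≤ 1) :
    |(x - y) / x - (log x - log y)| ≤ 1 / y - 1 / x := by
  have hx : 0 < x := hy.trans_le hyx
  have h1 : log x - log y ≤ (x - y) / y := by
    rw [← Real.log_div hx.ne' hy.ne']
    refine (Real.log_le_sub_one_of_pos (by positivity)).trans (le_of_eq ?_)
    field_simp
  have h2 : (x - y) / x ≤ log x - log y := by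
    rw [← Real.log_div hx.ne' hy.ne']
    have := Real.one_sub_inv_le_log_of_pos (x := x / y) (by positivity)
    refine (le_of_eq ?_).trans this
    field_simp
  rw [abs_sub_comm, abs_of_nonneg (by linarith)]
  have h3 : 0 ≤ 1 / y - 1 / x := sub_nonneg.2 (one_div_le_one_div_of_le hy hyx)
  calc _ ≤ (x - y) / y - (x - y) / x := by linarith
    _ = (x - y) * (1 / y - 1 / x) := by ring
    _ ≤ _ := by nlinarith

theorem sum_primesLE_succ (f : ℕ → ℝ) (n : ℕ) :
    ∑ p ∈ (n + 1).primesLE, f p =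
      ∑ p ∈ n.primesLE, f p + if (n + 1).Prime then f (n + 1) else 0 := by
  simp only [Nat.primesLE_eq_filter_range, Finset.sum_filter]
  rw [Finset.sum_range_succ]

/-- Mertens' second theorem, with an unspecified constant. -/
theorem exists_tendsto_sum_one_div_primesLE_sub_log_log :
    ∃ L, Tendsto (fun N : ℕ => ∑ p ∈ N.primesLE, 1 / (p : ℝ) - log (log N)) atTop (𝓝 L) := by
  obtain ⟨C, hC⟩ := exists_abs_sum_log_div_sub_log_le
  have hC0 : 0 ≤ C := (abs_nonneg _).trans (hC 1 le_rfl)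
  set E : ℕ → ℝ := fun N => ∑ p ∈ N.primesLE, log p / p - log N with hE
  have hloglim : Tendsto (fun n : ℕ => log (n : ℝ)) atTop atTop :=
    Real.tendsto_log_atTop.comp tendsto_natCast_atTop_atTop
  have hg0 : Tendsto (fun n : ℕ => (C + 1) * (1 / log (n : ℝ))) atTop (𝓝 0) := by
    simpa using (hloglim.inv_tendsto_atTop).const_mul (C + 1)
  have hquot : Tendsto (fun n : ℕ => E n / log (n : ℝ)) atTop (𝓝 0) := by
    refine squeeze_zero_norm' ?_ hg0
    filter_upwards [eventually_ge_atTop 2] with n hn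
    have hl : 0 < log (n : ℝ) := Real.log_pos (by exact_mod_cast hn)
    rw [norm_div, Real.norm_eq_abs, Real.norm_eq_abs, abs_of_pos hl, mul_one_div]
    gcongr
    linarith [hC n (by omega)]
  obtain ⟨L, hL⟩ := tendsto_of_abs_sub_le_sub
    (s := fun n => ∑ p ∈ (n + 2).primesLE, 1 / (p : ℝ) - log (log (n + 2 : ℕ)) -
      E (n + 2) / log (n + 2 : ℕ))
    (g := fun n => (C + 1) * (1 / log ((n + 2 : ℕ) : ℝ)))
    ((tendsto_add_atTop_iff_nat (f := fun n : ℕ => (C + 1) * (1 / log (n : ℝ))) 2).2 hg0) (by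
    intro n
    set m := n + 2 with hm
    have hm1 : n + 1 + 2 = m + 1 := by omega
    have hm2 : (2 : ℝ) ≤ m := by exact_mod_cast (by omega : 2 ≤ m)
    rw [hm1]
    have hy : 0 < log (m : ℝ) := Real.log_pos (by linarith)
    have hyx : log (m : ℝ) ≤ log ((m + 1 : ℕ) : ℝ) :=
      Real.log_le_log (by linarith) (by push_cast; linarith)
    have hx := hy.trans_le hyx
    have hxy : log ((m + 1 : ℕ) : ℝ) - log m ≤ 1 := by
      rw [← Real.log_div (by positivity) (by positivity)]
      refine (Real.log_le_sub_one_of_pos (by positivity)).trans ?_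
      rw [sub_le_iff_le_add, div_le_iff₀ (by positivity)]
      push_cast
      linarith
    have hmain := abs_log_sub_log_sub_le hy hyx hxy
    have hEm := hC m (by omega)
    have hdiff : E (m + 1) - E m = (if (m + 1).Prime then log (m + 1 : ℕ) / (m + 1 : ℕ) else 0) -
        (log ((m + 1 : ℕ) : ℝ) - log m) := by
      simp only [hE]
      rw [sum_primesLE_succ (fun p => log (p : ℝ) / p)]
      ring
    have hS := sum_primesLE_succ (fun p => 1 / (p : ℝ)) m
    have hq : (if (m + 1).Prime then 1 / ((m + 1 : ℕ) : ℝ) else 0) =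
        (if (m + 1).Prime then log (m + 1 : ℕ) / (m + 1 : ℕ) else 0) / log ((m + 1 : ℕ) : ℝ) := by
      split_ifs
      · field_simp
      · simp
    set x := log ((m + 1 : ℕ) : ℝ)
    set y := log (m : ℝ)
    have key : ∑ p ∈ (m + 1).primesLE, 1 / (p : ℝ) - log x - E (m + 1) / x -
        (∑ p ∈ m.primesLE, 1 / (p : ℝ) - log y - E m / y) =
        ((x - y) / x - (log x - log y)) + E m * (1 / y - 1 / x) := by
      rw [hS, hq, show E (m + 1) = E m + (E (m + 1) - E m) by ring, hdiff]
      ring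
    rw [key]
    have h3 : 0 ≤ 1 / y - 1 / x := sub_nonneg.2 (one_div_le_one_div_of_le hy hyx)
    calc _ ≤ |(x - y) / x - (log x - log y)| + |E m * (1 / y - 1 / x)| := abs_add_le _ _
      _ ≤ (1 / y - 1 / x) + C * (1 / y - 1 / x) := by
        rw [abs_mul, abs_of_nonneg h3]
        gcongr
      _ = _ := by ring)
  refine ⟨L, ?_⟩
  have h := ((tendsto_add_atTop_iff_nat (f := fun n : ℕ => ∑ p ∈ n.primesLE, 1 / (p : ℝ) -
    log (log n) - E n / log n) 2).1 hL).add hquot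
  simpa using h

/-- An Abelian theorem: if the counting function `D v = ∑_{u i ≤ v} c i` tends to `L`, then so does
`∑ c i * exp (-δ u i)` as `δ → 0⁺`. -/
theorem tendsto_tsum_mul_exp_neg {ι : Type*} [Countable ι] {c u : ι → ℝ} {D : ℝ → ℝ} {L C : ℝ}
    (hu : ∀ i, 0 ≤ u i) (hs : ∀ δ, 0 < δ → Summable fun i => c i * exp (-(δ * u i)))
    (hD : ∀ v, 0 ≤ v → HasSum (fun i => if u i ≤ v then c i else 0) (D v))
    (hmeas : Measurable D) (hbd : ∀ v, 0 ≤ v → |D v| ≤ C) (hL : Tendsto D atTop (𝓝 L)) :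
    Tendsto (fun δ => ∑' i, c i * exp (-(δ * u i))) (𝓝[>] 0) (𝓝 L) := by
  have hexp : MeasureTheory.IntegrableOn (fun v : ℝ => exp (-v)) (Set.Ici 0) :=
    (integrableOn_Ici_iff_integrableOn_Ioi).2 (integrableOn_exp_neg_Ioi 0)
  have hstep : ∀ a : ℝ, 0 ≤ a → ∀ b : ℝ,
      ∫ v in Set.Ici (0 : ℝ), (Set.Ici a).indicator (fun v => b * exp (-v)) v = b * exp (-a) := by
    intro a ha b
    rw [MeasureTheory.setIntegral_indicator measurableSet_Ici, Set.Ici_inter_Ici,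
      max_eq_right ha, MeasureTheory.integral_Ici_eq_integral_Ioi,
      MeasureTheory.integral_const_mul, integral_exp_neg_Ioi]
  have hrep : ∀ δ, 0 < δ →
      ∑' i, c i * exp (-(δ * u i)) = ∫ v in Set.Ici (0 : ℝ), D (v / δ) * exp (-v) := by
    intro δ hδ
    have hnonneg : ∀ i, 0 ≤ δ * u i := fun i => mul_nonneg hδ.le (hu i)
    have h := MeasureTheory.integral_tsum_of_summable_integral_norm
      (μ := MeasureTheory.volume.restrict (Set.Ici (0 : ℝ)))
      (F := fun i => (Set.Ici (δ * u i)).indicator fun v => c i * exp (-v))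
      (fun i => MeasureTheory.Integrable.indicator (hexp.const_mul (c i)) measurableSet_Ici) (by
        refine (hs δ hδ).norm.congr fun i => ?_
        simp_rw [norm_indicator_eq_indicator_norm, norm_mul, Real.norm_eq_abs, Real.abs_exp]
        rw [hstep _ (hnonneg i)])
    simp_rw [hstep _ (hnonneg _)] at h
    rw [h]
    refine MeasureTheory.setIntegral_congr_fun measurableSet_Ici fun v hv => ?_
    have hv' : 0 ≤ v / δ := div_nonneg hv hδ.le
    rw [← (hD _ hv').tsum_eq, ← tsum_mul_right]
    refine tsum_congr fun i => ?_
    simp only [Set.indicator, Set.mem_Ici, le_div_iff₀ hδ, mul_comm (u i) δ]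
    split_ifs <;> simp
  have hlim : Tendsto (fun δ : ℝ => ∫ v in Set.Ici (0 : ℝ), D (v / δ) * exp (-v)) (𝓝[>] 0)
      (𝓝 (∫ v in Set.Ici (0 : ℝ), L * exp (-v))) := by
    refine MeasureTheory.tendsto_integral_filter_of_dominated_convergence
      (fun v => C * exp (-v)) ?_ ?_ (hexp.const_mul C) ?_
    · refine Eventually.of_forall fun δ => Measurable.aestronglyMeasurable ?_
      exact (hmeas.comp (measurable_id.div_const δ)).mul (by fun_prop)
    · filter_upwards [self_mem_nhdsWithin] with δ hδ
      refine (MeasureTheory.ae_restrict_iff' measurableSet_Ici).2 (Eventually.of_forall ?_)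
      intro v hv
      rw [norm_mul, Real.norm_eq_abs, Real.norm_eq_abs, Real.abs_exp]
      gcongr
      exact hbd _ (div_nonneg hv (le_of_lt hδ))
    · rw [← MeasureTheory.Measure.restrict_congr_set MeasureTheory.Ioi_ae_eq_Ici]
      refine (MeasureTheory.ae_restrict_iff' measurableSet_Ioi).2 (Eventually.of_forall ?_)
      intro v hv
      refine Tendsto.mul_const _ (hL.comp ?_)
      exact (tendsto_inv_nhdsGT_zero.const_mul_atTop hv).congr fun δ => (div_eq_mul_inv v δ).symm
  rw [MeasureTheory.integral_Ici_eq_integral_Ioi, MeasureTheory.integral_const_mul,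
    integral_exp_neg_Ioi_zero, mul_one] at hlim
  refine hlim.congr' ?_
  filter_upwards [self_mem_nhdsWithin] with δ hδ using (hrep δ hδ).symm

theorem tendsto_sum_primesLE {f : ℕ → ℝ} (hf : Summable fun n => if n.Prime then f n else 0) :
    Tendsto (fun N : ℕ => ∑ p ∈ N.primesLE, f p) atTop
      (𝓝 (∑' n, if n.Prime then f n else 0)) := by
  refine ((tendsto_add_atTop_iff_nat 1).2 hf.tendsto_sum_tsum_nat).congr fun N => ?_
  rw [Nat.primesLE_eq_filter_range, Finset.sum_filter]

theorem tendsto_prod_primesLE_inv_one_sub_rpow {s : ℝ} (hs : 1 < s) :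
    Tendsto (fun N : ℕ => ∏ p ∈ N.primesLE, (1 - 1 / (p : ℝ) ^ s)⁻¹) atTop
      (𝓝 (∑' n : ℕ, 1 / (n : ℝ) ^ s)) := by
  let f : ℕ →*₀ ℝ :=
    { toFun := fun n => 1 / (n : ℝ) ^ s
      map_zero' := by simp [Real.zero_rpow (by linarith : s ≠ 0)]
      map_one' := by simp
      map_mul' := fun m n => by
        rw [Nat.cast_mul, Real.mul_rpow (by positivity) (by positivity), one_div_mul_one_div] }
  have h := EulerProduct.eulerProduct_completely_multiplicative (f := f)
    (Real.summable_one_div_nat_rpow.2 hs).norm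
  exact (tendsto_add_atTop_iff_nat 1).2 h

theorem abs_neg_log_one_sub_sub_le {x : ℝ} (h0 : 0 ≤ x) (h1 : x ≤ 1 / 2) :
    |-log (1 - x) - x| ≤ 2 * x ^ 2 := by
  have h := Real.abs_log_sub_add_sum_range_le (x := x) (by rw [abs_of_nonneg h0]; linarith) 1
  simp only [Finset.sum_range_one, zero_add, pow_one, Nat.cast_zero, div_one, abs_of_nonneg h0] at h
  rw [show -log (1 - x) - x = -(x + log (1 - x)) by ring, abs_neg]
  refine h.trans ?_
  rw [div_le_iff₀ (by linarith)]
  norm_num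
  nlinarith [sq_nonneg x]

/-- The difference between `log ζ(s)` and `∑ p⁻ˢ`, as a sum over primes. -/
noncomputable def primeLogRemainder (s : ℝ) : ℝ :=
  ∑' n : ℕ, if n.Prime then -log (1 - 1 / (n : ℝ) ^ s) - 1 / (n : ℝ) ^ s else 0

theorem one_div_rpow_le {n : ℕ} (hn : n.Prime) {s : ℝ} (hs : 1 ≤ s) :
    1 / (n : ℝ) ^ s ≤ 1 / n := by
  have h1 : (1 : ℝ) ≤ n := by exact_mod_cast hn.one_le
  refine one_div_le_one_div_of_le (by linarith) ?_
  simpa using Real.rpow_le_rpow_of_exponent_le h1 hs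

theorem one_div_rpow_le_half {n : ℕ} (hn : n.Prime) {s : ℝ} (hs : 1 ≤ s) :
    1 / (n : ℝ) ^ s ≤ 1 / 2 :=
  (one_div_rpow_le hn hs).trans
    (one_div_le_one_div_of_le (by norm_num) (by exact_mod_cast hn.two_le))

theorem norm_primeLogRemainder_term_le (n : ℕ) {s : ℝ} (hs : 1 ≤ s) :
    ‖if n.Prime then -log (1 - 1 / (n : ℝ) ^ s) - 1 / (n : ℝ) ^ s else 0‖ ≤
      2 * (1 / (n : ℝ) ^ 2) := by
  split_ifs with hn
  · refine (abs_neg_log_one_sub_sub_le (by positivity) (one_div_rpow_le_half hn hs)).trans ?_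
    rw [← one_div_pow]
    exact mul_le_mul_of_nonneg_left
      (pow_le_pow_left₀ (by positivity) (one_div_rpow_le hn hs) 2) zero_le_two
  · simp

theorem summable_two_mul_one_div_sq : Summable fun n : ℕ => 2 * (1 / (n : ℝ) ^ 2) :=
  (Real.summable_one_div_nat_pow.2 one_lt_two).mul_left 2

theorem summable_primeLogRemainder {s : ℝ} (hs : 1 ≤ s) :
    Summable fun n : ℕ =>
      if n.Prime then -log (1 - 1 / (n : ℝ) ^ s) - 1 / (n : ℝ) ^ s else 0 :=
  Summable.of_norm_bounded summable_two_mul_one_div_sq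
    fun n => norm_primeLogRemainder_term_le n hs

theorem tendsto_primeLogRemainder :
    Tendsto primeLogRemainder (𝓝[>] 1) (𝓝 (primeLogRemainder 1)) := by
  refine tendsto_tsum_of_dominated_convergence summable_two_mul_one_div_sq (fun n => ?_) ?_
  · split_ifs with hn
    · have hn0 : (n : ℝ) ≠ 0 := by exact_mod_cast hn.ne_zero
      have hc : Tendsto (fun s : ℝ => 1 / (n : ℝ) ^ s) (𝓝[>] 1) (𝓝 (1 / (n : ℝ) ^ (1 : ℝ))) := by
        refine tendsto_const_nhds.div ?_ (by simpa using hn0)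
        exact ((Real.continuousAt_const_rpow hn0).tendsto).mono_left nhdsWithin_le_nhds
      refine Tendsto.sub (Tendsto.neg (Tendsto.log (tendsto_const_nhds.sub hc) ?_)) hc
      linarith [one_div_rpow_le_half hn le_rfl]
    · exact tendsto_const_nhds
  · filter_upwards [self_mem_nhdsWithin] with s hs n
    exact norm_primeLogRemainder_term_le n (le_of_lt hs)

theorem summable_prime_one_div_rpow {s : ℝ} (hs : 1 < s) :
    Summable fun n : ℕ => if n.Prime then 1 / (n : ℝ) ^ s else 0 := by
  refine Summable.of_nonneg_of_le (fun n => ?_) (fun n => ?_) (Real.summable_one_div_nat_rpow.2 hs)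
  · split_ifs <;> positivity
  · split_ifs
    · exact le_rfl
    · positivity

theorem tsum_prime_one_div_rpow {s : ℝ} (hs : 1 < s) :
    ∑' n : ℕ, (if n.Prime then 1 / (n : ℝ) ^ s else 0) =
      log (∑' n : ℕ, 1 / (n : ℝ) ^ s) - primeLogRemainder s := by
  have hZ : 0 < ∑' n : ℕ, 1 / (n : ℝ) ^ s :=
    (Real.summable_one_div_nat_rpow.2 hs).tsum_pos (fun n => by positivity) 1 (by simp)
  have h1 := (tendsto_prod_primesLE_inv_one_sub_rpow hs).log hZ.ne'
  have h2 := tendsto_sum_primesLE (summable_primeLogRemainder hs.le)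
  refine tendsto_nhds_unique (tendsto_sum_primesLE (summable_prime_one_div_rpow hs))
    ((h1.sub h2).congr fun N => ?_)
  rw [Real.log_prod]
  · rw [← Finset.sum_sub_distrib]
    refine Finset.sum_congr rfl fun p hp => ?_
    rw [Real.log_inv]
    ring
  · intro p hp
    have := one_div_rpow_le_half (Nat.prime_of_mem_primesLE hp) hs.le
    exact inv_ne_zero (by linarith)

/-- `∑_{p ≤ eᵛ} 1 / p - ∑_{k ≤ v} 1 / k`. -/
noncomputable def primeHarmonicDiff (v : ℝ) : ℝ :=
  ∑ p ∈ (⌊exp v⌋₊).primesLE, 1 / (p : ℝ) - (harmonic ⌊v⌋₊ : ℝ)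

theorem measurable_primeHarmonicDiff : Measurable primeHarmonicDiff := by
  refine Measurable.sub ?_ ?_
  · exact (measurable_from_nat (f := fun n : ℕ => ∑ p ∈ n.primesLE, 1 / (p : ℝ))).comp
      (Nat.measurable_floor.comp Real.measurable_exp)
  · exact (measurable_from_nat (f := fun n : ℕ => (harmonic n : ℝ))).comp Nat.measurable_floor

theorem harmonic_cast_eq_sum_Icc (n : ℕ) :
    (harmonic n : ℝ) = ∑ k ∈ Finset.Icc 1 n, 1 / (k : ℝ) := by
  rw [harmonic_eq_sum_Icc]
  push_cast
  simp

theorem hasSum_primeHarmonicDiff {v : ℝ} (hv : 0 ≤ v) :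
    HasSum (fun i : ℕ ⊕ ℕ =>
      if Sum.elim (fun n : ℕ => log (n : ℝ)) (fun k : ℕ => (k : ℝ)) i ≤ v then
        Sum.elim (fun n : ℕ => if n.Prime then 1 / (n : ℝ) else 0) (fun k : ℕ => -(1 / (k : ℝ))) i
      else 0) (primeHarmonicDiff v) := by
  rw [primeHarmonicDiff, sub_eq_add_neg]
  refine HasSum.sum ?_ ?_
  · have hmem : ∀ n : ℕ, n.Prime → (n ∈ (⌊exp v⌋₊).primesLE ↔ log (n : ℝ) ≤ v) := by
      intro n hn
      rw [Nat.mem_primesLE, Nat.le_floor_iff (exp_pos v).le,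
        Real.log_le_iff_le_exp (by exact_mod_cast hn.pos)]
      simp [hn]
    rw [Finset.sum_congr rfl (g := fun n : ℕ =>
      if log (n : ℝ) ≤ v then (if n.Prime then 1 / (n : ℝ) else 0) else 0)]
    · refine hasSum_sum_of_ne_finset_zero fun n hn => ?_
      simp only [Function.comp_apply, Sum.elim_inl]
      by_cases h2 : n.Prime
      · exact if_neg fun h1 => hn ((hmem n h2).2 h1)
      · rw [if_neg h2]
        exact ite_self _
    · intro n hn
      have hp := Nat.prime_of_mem_primesLE hn
      rw [if_pos ((hmem n hp).1 hn), if_pos hp]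
  · rw [harmonic_cast_eq_sum_Icc, ← Finset.sum_neg_distrib,
      Finset.sum_congr rfl (g := fun n : ℕ => if (n : ℝ) ≤ v then -(1 / (n : ℝ)) else 0)]
    · refine hasSum_sum_of_ne_finset_zero fun n hn => ?_
      simp only [Function.comp_apply, Sum.elim_inr]
      by_cases h1 : (n : ℝ) ≤ v
      · rw [Finset.mem_Icc, Nat.le_floor_iff hv] at hn
        have : n = 0 := by
          by_contra h
          exact hn ⟨Nat.one_le_iff_ne_zero.2 h, h1⟩
        simp [this]
      · exact if_neg h1
    · intro n hn
      rw [if_pos ((Nat.le_floor_iff hv).1 (Finset.mem_Icc.1 hn).2)]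

theorem tendsto_log_log_floor_exp_sub_log_floor :
    Tendsto (fun v : ℝ => log (log (⌊exp v⌋₊ : ℝ)) - log (⌊v⌋₊ : ℝ)) atTop (𝓝 0) := by
  have h1 : Tendsto (fun v : ℝ => log ((⌊exp v⌋₊ : ℝ) / exp v)) atTop (𝓝 0) := by
    rw [← Real.log_one]
    exact ((tendsto_nat_floor_div_atTop (R := ℝ)).comp tendsto_exp_atTop).log one_ne_zero
  have h2 : Tendsto (fun v : ℝ => log ((⌊exp v⌋₊ : ℝ) / exp v) * v⁻¹ + 1) atTop (𝓝 1) := by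
    simpa using (h1.mul tendsto_inv_atTop_zero).add_const 1
  have h3 := h2.div (tendsto_nat_floor_div_atTop (R := ℝ)) one_ne_zero
  have h4 := h3.log (by norm_num)
  rw [div_one, Real.log_one] at h4
  refine h4.congr' ?_
  filter_upwards [eventually_ge_atTop 2] with v hv
  have hf : 0 < (⌊v⌋₊ : ℝ) := by exact_mod_cast Nat.floor_pos.2 (by linarith)
  have he : 2 ≤ exp v := by linarith [Real.add_one_le_exp v]
  have hN : (2 : ℝ) ≤ ⌊exp v⌋₊ := by exact_mod_cast (Nat.le_floor (by exact_mod_cast he))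
  have hl : 0 < log (⌊exp v⌋₊ : ℝ) := Real.log_pos (by linarith)
  rw [← Real.log_div hl.ne' hf.ne', Pi.div_apply, Real.log_div (by linarith) (exp_pos v).ne',
    Real.log_exp]
  congr 1
  field_simp
  ring

theorem tendsto_primeHarmonicDiff {L : ℝ}
    (hL : Tendsto (fun N : ℕ => ∑ p ∈ N.primesLE, 1 / (p : ℝ) - log (log N)) atTop (𝓝 L)) :
    Tendsto primeHarmonicDiff atTop (𝓝 (L - eulerMascheroniConstant)) := by
  have h1 := hL.comp ((tendsto_nat_floor_atTop (α := ℝ)).comp tendsto_exp_atTop)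
  have h2 := Real.tendsto_harmonic_sub_log.comp (tendsto_nat_floor_atTop (α := ℝ))
  have h := (h1.sub h2).add tendsto_log_log_floor_exp_sub_log_floor
  rw [add_zero] at h
  refine h.congr fun v => ?_
  simp only [Function.comp_apply, primeHarmonicDiff]
  ring

theorem exists_abs_primeHarmonicDiff_le {L : ℝ} (hL : Tendsto primeHarmonicDiff atTop (𝓝 L)) :
    ∃ C, ∀ v, 0 ≤ v → |primeHarmonicDiff v| ≤ C := by
  obtain ⟨V, hV⟩ := eventually_atTop.1 (hL.abs.eventually (ge_mem_nhds (lt_add_one |L|)))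
  set B := ∑ p ∈ (⌊exp V⌋₊).primesLE, 1 / (p : ℝ) + (harmonic ⌊V⌋₊ : ℝ)
  refine ⟨max (|L| + 1) B, fun v _ => ?_⟩
  rcases le_total V v with h | h
  · exact (hV v h).trans (le_max_left _ _)
  · refine le_trans ?_ (le_max_right _ _)
    have e1 : ∑ p ∈ (⌊exp v⌋₊).primesLE, 1 / (p : ℝ) ≤ ∑ p ∈ (⌊exp V⌋₊).primesLE, 1 / (p : ℝ) := by
      refine Finset.sum_le_sum_of_subset_of_nonneg (fun p hp => ?_) (fun _ _ _ => by positivity)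
      rw [Nat.mem_primesLE] at hp ⊢
      exact ⟨hp.1.trans (Nat.floor_mono (exp_le_exp.2 h)), hp.2⟩
    have e2 : (harmonic ⌊v⌋₊ : ℝ) ≤ harmonic ⌊V⌋₊ := by
      rw [harmonic_cast_eq_sum_Icc, harmonic_cast_eq_sum_Icc]
      exact Finset.sum_le_sum_of_subset_of_nonneg
        (Finset.Icc_subset_Icc_right (Nat.floor_mono h)) (fun _ _ _ => by positivity)
    have e3 : 0 ≤ ∑ p ∈ (⌊exp v⌋₊).primesLE, 1 / (p : ℝ) :=
      Finset.sum_nonneg fun _ _ => by positivity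
    have e4 : (0 : ℝ) ≤ harmonic ⌊v⌋₊ := by
      rw [harmonic_cast_eq_sum_Icc]
      exact Finset.sum_nonneg fun _ _ => by positivity
    rw [primeHarmonicDiff, abs_le]
    constructor <;> linarith

theorem hasSum_prime_mul_exp_neg {δ : ℝ} (hδ : 0 < δ) :
    HasSum (fun n : ℕ => (if n.Prime then 1 / (n : ℝ) else 0) * exp (-(δ * log n)))
      (log (∑' n : ℕ, 1 / (n : ℝ) ^ (1 + δ)) - primeLogRemainder (1 + δ)) := by
  have hs : 1 < 1 + δ := by linarith
  rw [← tsum_prime_one_div_rpow hs]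
  convert (summable_prime_one_div_rpow hs).hasSum using 2 with n
  split_ifs with hn
  · have hn0 : (0 : ℝ) < n := by exact_mod_cast hn.pos
    rw [Real.rpow_add hn0, Real.rpow_one, Real.rpow_def_of_pos hn0, Real.exp_neg, mul_comm δ]
    field_simp
  · simp

theorem hasSum_neg_one_div_mul_exp_neg {δ : ℝ} (hδ : 0 < δ) :
    HasSum (fun k : ℕ => -(1 / (k : ℝ)) * exp (-(δ * k))) (log (1 - exp (-δ))) := by
  have h := (Real.hasSum_pow_div_log_of_abs_lt_one (x := exp (-δ))
    (by rw [Real.abs_exp]; exact Real.exp_lt_one_iff.2 (by linarith))).neg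
  rw [neg_neg] at h
  rw [← hasSum_nat_add_iff' 1]
  simp only [Finset.sum_range_one, Nat.cast_zero, div_zero, neg_zero, zero_mul, sub_zero]
  refine h.congr_fun fun k => ?_
  rw [← Real.exp_nat_mul]
  push_cast
  rw [show -(δ * ((k : ℝ) + 1)) = ((k : ℝ) + 1) * -δ by ring]
  ring

theorem tendsto_one_add_nhdsGT_zero : Tendsto (fun δ : ℝ => 1 + δ) (𝓝[>] 0) (𝓝[>] 1) := by
  refine tendsto_nhdsWithin_iff.2 ⟨?_, ?_⟩
  · have : Tendsto (fun δ : ℝ => 1 + δ) (𝓝 0) (𝓝 (1 + 0)) := (continuous_const_add 1).tendsto 0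
    rw [add_zero] at this
    exact this.mono_left nhdsWithin_le_nhds
  · filter_upwards [self_mem_nhdsWithin] with δ hδ
    exact lt_add_of_pos_right 1 (Set.mem_Ioi.1 hδ)

theorem tendsto_log_zeta_add_log_one_sub_exp :
    Tendsto (fun δ : ℝ => log (∑' n : ℕ, 1 / (n : ℝ) ^ (1 + δ)) + log (1 - exp (-δ)))
      (𝓝[>] 0) (𝓝 0) := by
  have h1 := (tendsto_sub_mul_tsum_nat_rpow.comp tendsto_one_add_nhdsGT_zero).log one_ne_zero
  have hd : HasDerivAt (fun x : ℝ => 1 - exp (-x)) 1 0 := by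
    have := ((hasDerivAt_neg (0 : ℝ)).exp).const_sub 1
    simpa using this
  have h2 := hd.tendsto_slope_zero_right.log one_ne_zero
  have h := h1.add h2
  rw [Real.log_one, add_zero] at h
  refine h.congr' ?_
  filter_upwards [self_mem_nhdsWithin] with δ hδ
  have hδ' : 0 < δ := hδ
  have hZ : 0 < ∑' n : ℕ, 1 / (n : ℝ) ^ (1 + δ) :=
    (Real.summable_one_div_nat_rpow.2 (by linarith)).tsum_pos (fun n => by positivity) 1 (by simp)
  have he : 0 < 1 - exp (-δ) := sub_pos.2 (Real.exp_lt_one_iff.2 (by linarith))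
  simp only [Function.comp_apply, add_sub_cancel_left, zero_add, neg_zero, Real.exp_zero, sub_self,
    sub_zero, smul_eq_mul]
  rw [Real.log_mul hδ'.ne' hZ.ne', Real.log_mul (inv_ne_zero hδ'.ne') he.ne', Real.log_inv]
  ring

/-- Mertens' second theorem, with the constant expressed through `γ`. -/
theorem tendsto_sum_one_div_primesLE_sub_log_log :
    Tendsto (fun N : ℕ => ∑ p ∈ N.primesLE, 1 / (p : ℝ) - log (log N)) atTop
      (𝓝 (eulerMascheroniConstant - primeLogRemainder 1)) := by
  obtain ⟨L, hL⟩ := exists_tendsto_sum_one_div_primesLE_sub_log_log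
  have hD := tendsto_primeHarmonicDiff hL
  obtain ⟨C, hC⟩ := exists_abs_primeHarmonicDiff_le hD
  set c : ℕ ⊕ ℕ → ℝ :=
    Sum.elim (fun n : ℕ => if n.Prime then 1 / (n : ℝ) else 0) (fun k : ℕ => -(1 / (k : ℝ)))
  set u : ℕ ⊕ ℕ → ℝ := Sum.elim (fun n : ℕ => log (n : ℝ)) (fun k : ℕ => (k : ℝ))
  have hu : ∀ i, 0 ≤ u i := by
    rintro (n | k)
    · exact Real.log_natCast_nonneg n
    · exact Nat.cast_nonneg k
  have hsum : ∀ δ, 0 < δ → HasSum (fun i => c i * exp (-(δ * u i)))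
      (log (∑' n : ℕ, 1 / (n : ℝ) ^ (1 + δ)) - primeLogRemainder (1 + δ) + log (1 - exp (-δ))) :=
    fun δ hδ => HasSum.sum (hasSum_prime_mul_exp_neg hδ) (hasSum_neg_one_div_mul_exp_neg hδ)
  have h1 := tendsto_tsum_mul_exp_neg hu (fun δ hδ => (hsum δ hδ).summable)
    (fun v hv => hasSum_primeHarmonicDiff hv) measurable_primeHarmonicDiff hC hD
  have h2 := tendsto_log_zeta_add_log_one_sub_exp.sub
    (tendsto_primeLogRemainder.comp tendsto_one_add_nhdsGT_zero)
  have h3 : L - eulerMascheroniConstant = 0 - primeLogRemainder 1 := by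
    refine tendsto_nhds_unique h1 (h2.congr' ?_)
    filter_upwards [self_mem_nhdsWithin] with δ hδ
    rw [(hsum δ hδ).tsum_eq, Function.comp_apply]
    ring
  rwa [show eulerMascheroniConstant - primeLogRemainder 1 = L by linarith]

/-- Mertens' third theorem. -/
theorem tendsto_prod_primesLE_inv_one_sub_div_log :
    Tendsto (fun N : ℕ => (∏ p ∈ N.primesLE, (1 - 1 / (p : ℝ))⁻¹) / log N) atTop
      (𝓝 (exp eulerMascheroniConstant)) := by
  have h1 := tendsto_sum_primesLE (summable_primeLogRemainder (le_refl (1 : ℝ)))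
  have h2 := tendsto_sum_one_div_primesLE_sub_log_log.add h1
  rw [← primeLogRemainder, sub_add_cancel] at h2
  refine ((Real.continuous_exp.tendsto _).comp h2).congr' ?_
  filter_upwards [eventually_ge_atTop 2] with N hN
  have hl : 0 < log (N : ℝ) := Real.log_pos (by exact_mod_cast hN)
  rw [Function.comp_apply, show ∀ a b c : ℝ, a - b + c = (a + c) - b from fun a b c => by ring,
    Real.exp_sub, Real.exp_log hl, ← Finset.sum_add_distrib, Real.exp_sum]
  congr 1
  refine Finset.prod_congr rfl fun p hp => ?_
  have hp2 : (2 : ℝ) ≤ p := by exact_mod_cast (Nat.prime_of_mem_primesLE hp).two_le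
  have : 0 < 1 - 1 / (p : ℝ) := sub_pos.2 ((div_lt_one (by linarith)).2 (by linarith))
  rw [Real.rpow_one, add_sub_cancel, Real.exp_neg, Real.exp_log this]

theorem tendsto_prod_primesLE_one_add_div_log :
    Tendsto (fun N : ℕ => (∏ p ∈ N.primesLE, (1 + 1 / (p : ℝ))) / log N) atTop
      (𝓝 (6 / π ^ 2 * exp eulerMascheroniConstant)) := by
  have h1 := (tendsto_prod_primesLE_inv_one_sub_rpow one_lt_two).inv₀ (by
    simp only [Real.rpow_two]
    rw [hasSum_zeta_two.tsum_eq]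
    positivity)
  simp only [Real.rpow_two] at h1
  rw [hasSum_zeta_two.tsum_eq, inv_div] at h1
  refine (h1.mul tendsto_prod_primesLE_inv_one_sub_div_log).congr fun N => ?_
  rw [← mul_div_assoc, ← Finset.prod_inv_distrib, ← Finset.prod_mul_distrib]
  congr 1
  refine Finset.prod_congr rfl fun p hp => ?_
  have hp2 : (2 : ℝ) ≤ p := by exact_mod_cast (Nat.prime_of_mem_primesLE hp).two_le
  have : 1 - 1 / (p : ℝ) ≠ 0 := (sub_pos.2 ((div_lt_one (by linarith)).2 (by linarith))).ne'
  rw [inv_inv, ← div_eq_mul_inv, div_eq_iff this]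
  ring

theorem sum_divisors_pow_le {p ν : ℕ} (hp : 2 ≤ p) (hν : 1 ≤ ν) :
    ∑ d ∈ ν.divisors, (p : ℝ) ^ d ≤ (p : ℝ) ^ ν * if 2 ≤ ν then 1 + 1 / (p : ℝ) else 1 := by
  have hp0 : (0 : ℝ) < p := by exact_mod_cast (by omega : 0 < p)
  rcases (by omega : ν = 1 ∨ ν = 2 ∨ 3 ≤ ν) with rfl | rfl | h3
  · simp
  · rw [if_pos le_rfl, Nat.Prime.sum_divisors Nat.prime_two]
    refine le_of_eq ?_
    field_simp
  · have h : ∑ d ∈ ν.properDivisors, p ^ d < p ^ (ν - 1) := by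
      refine Nat.geomSum_lt hp fun d hd => ?_
      rw [Nat.mem_properDivisors] at hd
      obtain ⟨⟨k, rfl⟩, hlt⟩ := hd
      have hk : 2 ≤ k := by
        by_contra hk
        have : d * k ≤ d * 1 := Nat.mul_le_mul_left d (by omega)
        omega
      have := Nat.mul_le_mul_left d hk
      omega
    have h' : ∑ d ∈ ν.properDivisors, (p : ℝ) ^ d ≤ (p : ℝ) ^ (ν - 1) := by exact_mod_cast h.le
    rw [if_pos (by omega), ← Nat.cons_self_properDivisors (by omega), Finset.sum_cons, mul_add,
      mul_one, mul_one_div, ← pow_sub_one_mul (by omega : ν ≠ 0), mul_div_cancel_right₀ _ hp0.ne']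
    gcongr

theorem exponential_sigma_le {σe : ℕ → ℝ} (h1 : σe 1 = 1)
    (hm : ∀ m n : ℕ, Nat.Coprime m n → σe (m * n) = σe m * σe n)
    (hpp : ∀ p ν : ℕ, p.Prime → 1 ≤ ν → σe (p ^ ν) = ∑ d ∈ ν.divisors, (p : ℝ) ^ d)
    {n : ℕ} (hn : n ≠ 0) :
    0 ≤ σe n ∧
      σe n ≤ n * ∏ p ∈ n.primeFactors with 2 ≤ n.factorization p, (1 + 1 / (p : ℝ)) := by
  have hfac : σe n = ∏ p ∈ n.primeFactors, ∑ d ∈ (n.factorization p).divisors, (p : ℝ) ^ d := by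
    rw [Nat.multiplicative_factorization σe hm h1 hn, Finsupp.prod, Nat.support_factorization]
    refine Finset.prod_congr rfl fun p hp => hpp p _ (Nat.prime_of_mem_primeFactors hp) ?_
    exact (Nat.prime_of_mem_primeFactors hp).factorization_pos_of_dvd hn
      (Nat.dvd_of_mem_primeFactors hp)
  have hself : (n : ℝ) = ∏ p ∈ n.primeFactors, (p : ℝ) ^ n.factorization p := by
    conv_lhs => rw [← Nat.prod_factorization_pow_eq_self hn]
    rw [Finsupp.prod, Nat.support_factorization]
    push_cast
    rfl
  refine ⟨hfac ▸ Finset.prod_nonneg fun p _ => by positivity, ?_⟩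
  rw [Finset.prod_filter, hfac]
  rw [hself]
  rw [← Finset.prod_mul_distrib]
  refine Finset.prod_le_prod (fun p _ => by positivity) fun p hp => ?_
  exact sum_divisors_pow_le (Nat.prime_of_mem_primeFactors hp).two_le
    ((Nat.prime_of_mem_primeFactors hp).factorization_pos_of_dvd hn
      (Nat.dvd_of_mem_primeFactors hp))

theorem card_large_primeFactors_mul_log_le {n : ℕ} (hn : n ≠ 0) {y : ℝ} (hy : 0 < y)
    {S : Finset ℕ} (hS : S ⊆ n.primeFactors) (hlt : ∀ p ∈ S, y ≤ p) :
    (S.card : ℝ) * log y ≤ log n := by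
  have hprod : ∏ p ∈ S, p ≤ n :=
    Nat.le_of_dvd (Nat.pos_of_ne_zero hn)
      ((Finset.prod_dvd_prod_of_subset _ _ _ hS).trans (Nat.prod_primeFactors_dvd n))
  rw [← Real.log_pow]
  refine Real.log_le_log (by positivity) ?_
  calc y ^ S.card = ∏ _p ∈ S, y := by simp
    _ ≤ ∏ p ∈ S, (p : ℝ) := Finset.prod_le_prod (fun _ _ => hy.le) hlt
    _ ≤ n := by
      rw [← Nat.cast_prod]
      exact_mod_cast hprod

theorem prod_one_add_one_div_primeFactors_le {n : ℕ} (hn : 1 < log (log n))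
    {S : Finset ℕ} (hS : S ⊆ n.primeFactors) :
    ∏ p ∈ S, (1 + 1 / (p : ℝ)) ≤
      (∏ p ∈ (⌊log n⌋₊).primesLE, (1 + 1 / (p : ℝ))) * exp (1 / log (log n)) := by
  have hn0 : n ≠ 0 := by
    rintro rfl
    norm_num at hn
  have hlog : 0 < log (n : ℝ) := by
    refine lt_of_le_of_ne (Real.log_natCast_nonneg n) fun h => ?_
    rw [← h] at hn
    norm_num at hn
  rw [← Finset.prod_filter_mul_prod_filter_not S (fun p : ℕ => p ≤ ⌊log n⌋₊)]
  refine mul_le_mul ?_ ?_ (Finset.prod_nonneg fun _ _ => by positivity)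
    (Finset.prod_nonneg fun _ _ => by positivity)
  · refine Finset.prod_le_prod_of_subset_of_one_le (fun p hp => ?_) (fun _ _ => by positivity)
      (fun p _ _ => by simp)
    rw [Finset.mem_filter] at hp
    exact Nat.mem_primesLE.2 ⟨hp.2, Nat.prime_of_mem_primeFactors (hS hp.1)⟩
  · set T := S.filter fun p : ℕ => ¬p ≤ ⌊log n⌋₊
    have hT : ∀ p ∈ T, log (n : ℝ) ≤ p := by
      intro p hp
      have := (Finset.mem_filter.1 hp).2
      exact ((Nat.floor_lt hlog.le).1 (not_le.1 this)).le
    have hcard := card_large_primeFactors_mul_log_le hn0 hlog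
      ((Finset.filter_subset _ S).trans hS : T ⊆ _) hT
    calc ∏ p ∈ T, (1 + 1 / (p : ℝ)) ≤ ∏ _p ∈ T, exp (1 / log n) := by
          refine Finset.prod_le_prod (fun _ _ => by positivity) fun p hp => ?_
          have := one_div_le_one_div_of_le hlog (hT p hp)
          linarith [Real.add_one_le_exp (1 / log (n : ℝ))]
      _ = exp (T.card * (1 / log n)) := by rw [Finset.prod_const, Real.exp_nat_mul]
      _ ≤ exp (1 / log (log n)) := by
          refine exp_le_exp.2 ?_
          rw [mul_one_div, div_le_div_iff₀ hlog (by linarith), one_mul]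
          exact hcard

theorem tendsto_log_log_natCast : Tendsto (fun n : ℕ => log (log n)) atTop atTop :=
  Real.tendsto_log_atTop.comp (Real.tendsto_log_atTop.comp tendsto_natCast_atTop_atTop)

theorem log_primorial_sq_le (N : ℕ) : log ((primorial N ^ 2 : ℕ) : ℝ) ≤ 2 * log 4 * N := by
  have h := Chebyshev.theta_le_log4_mul_x (x := N) (Nat.cast_nonneg N)
  rw [Chebyshev.theta_eq_log_primorial, Nat.floor_natCast] at h
  rw [Nat.cast_pow, Real.log_pow]
  push_cast
  linarith

theorem tendsto_primorial_sq_atTop : Tendsto (fun N => primorial N ^ 2) atTop atTop := by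
  refine tendsto_atTop.2 fun b => ?_
  obtain ⟨p, hbp, hp⟩ := Nat.exists_infinite_primes b
  filter_upwards [eventually_ge_atTop p] with N hN
  have hdvd : p ∣ primorial N :=
    Finset.dvd_prod_of_mem _ (by simpa [hp] using Nat.lt_succ_of_le hN)
  exact hbp.trans ((Nat.le_of_dvd (primorial_pos N) hdvd).trans (Nat.le_self_pow two_ne_zero _))

theorem exponential_sigma_primorial_sq {σe : ℕ → ℝ} (h1 : σe 1 = 1)
    (hm : ∀ m n : ℕ, Nat.Coprime m n → σe (m * n) = σe m * σe n)
    (hpp : ∀ p ν : ℕ, p.Prime → 1 ≤ ν → σe (p ^ ν) = ∑ d ∈ ν.divisors, (p : ℝ) ^ d) (N : ℕ) :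
    σe (primorial N ^ 2) =
      ((primorial N ^ 2 : ℕ) : ℝ) * ∏ p ∈ N.primesLE, (1 + 1 / (p : ℝ)) := by
  have hprim : primorial N = ∏ p ∈ N.primesLE, p := rfl
  rw [hprim]
  have hmain : ∀ S : Finset ℕ, (∀ p ∈ S, p.Prime) →
      σe ((∏ p ∈ S, p) ^ 2) = (((∏ p ∈ S, p) ^ 2 : ℕ) : ℝ) * ∏ p ∈ S, (1 + 1 / (p : ℝ)) := by
    intro S
    induction S using Finset.induction_on with
    | empty => simp [h1]
    | insert q S hq ih =>
      intro hS
      have hqp : q.Prime := hS q (Finset.mem_insert_self q S)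
      have hS' : ∀ p ∈ S, p.Prime := fun p hp => hS p (Finset.mem_insert_of_mem hp)
      have hcop : Nat.Coprime (q ^ 2) ((∏ p ∈ S, p) ^ 2) := by
        refine Nat.Coprime.pow _ _ (Nat.Coprime.prod_right fun p hp => ?_)
        exact (Nat.coprime_primes hqp (hS' p hp)).2 fun h => hq (h ▸ hp)
      have hq0 : (q : ℝ) ≠ 0 := by exact_mod_cast hqp.ne_zero
      rw [Finset.prod_insert hq, Finset.prod_insert hq, mul_pow, hm _ _ hcop, ih hS',
        hpp q 2 hqp one_le_two, Nat.Prime.sum_divisors Nat.prime_two]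
      push_cast
      field_simp
  exact hmain _ fun p hp => Nat.prime_of_mem_primesLE hp

/-- **Exponential divisor-sum (Fabrykowski–Subbarao).** If `σᵉ` is the multiplicative
function with `σᵉ(p^ν) = ∑_{d ∣ ν} p^d` (the sum of exponential divisors), then
`limsup σᵉ(n)/(n log log n) = (6/π²) e^γ`. -/
theorem limsup_exponential_sigma_div_eq
    (σe : ℕ → ℝ) (h1 : σe 1 = 1)
    (hm : ∀ m n : ℕ, Nat.Coprime m n → σe (m * n) = σe m * σe n)
    (hpp : ∀ p ν : ℕ, p.Prime → 1 ≤ ν →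
      σe (p ^ ν) = ∑ d ∈ ν.divisors, (p : ℝ) ^ d) :
    Filter.limsup (fun n : ℕ => σe n / (n * Real.log (Real.log n))) Filter.atTop =
      6 / Real.pi ^ 2 * Real.exp Real.eulerMascheroniConstant := by
  set M : ℕ → ℝ := fun N => (∏ p ∈ N.primesLE, (1 + 1 / (p : ℝ))) / log N
  have hM : Tendsto M atTop (𝓝 (6 / π ^ 2 * exp eulerMascheroniConstant)) :=
    tendsto_prod_primesLE_one_add_div_log
  have hfloor : Tendsto (fun n : ℕ => ⌊log (n : ℝ)⌋₊) atTop atTop :=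
    tendsto_nat_floor_atTop.comp (Real.tendsto_log_atTop.comp tendsto_natCast_atTop_atTop)
  have hU : Tendsto (fun n : ℕ => M ⌊log (n : ℝ)⌋₊ * exp (1 / log (log n))) atTop
      (𝓝 (6 / π ^ 2 * exp eulerMascheroniConstant)) := by
    have h0 : Tendsto (fun n : ℕ => exp (1 / log (log n))) atTop (𝓝 1) := by
      have h := (Real.continuous_exp.tendsto 0).comp (tendsto_log_log_natCast.const_div_atTop 1)
      rwa [Real.exp_zero] at h
    simpa using (hM.comp hfloor).mul h0
  have hlarge : ∀ᶠ n : ℕ in atTop, 1 < log (log n) ∧ n ≠ 0 ∧ 2 ≤ ⌊log (n : ℝ)⌋₊ :=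
    (tendsto_log_log_natCast.eventually_gt_atTop 1).and
      ((eventually_ne_atTop 0).and (hfloor.eventually_ge_atTop 2))
  have hle : ∀ᶠ n : ℕ in atTop,
      σe n / (n * log (log n)) ≤ M ⌊log (n : ℝ)⌋₊ * exp (1 / log (log n)) := by
    filter_upwards [hlarge] with n ⟨hll, hn0, hfl⟩
    have hn : (0 : ℝ) < n := by exact_mod_cast Nat.pos_of_ne_zero hn0
    have hfl' : (2 : ℝ) ≤ ⌊log (n : ℝ)⌋₊ := by exact_mod_cast hfl
    have hlogfl : 0 < log (⌊log (n : ℝ)⌋₊ : ℝ) := Real.log_pos (by linarith)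
    have hlogle : log (⌊log (n : ℝ)⌋₊ : ℝ) ≤ log (log n) :=
      Real.log_le_log (by linarith) (Nat.floor_le (Real.log_natCast_nonneg n))
    have hP : 0 ≤ ∏ p ∈ (⌊log (n : ℝ)⌋₊).primesLE, (1 + 1 / (p : ℝ)) :=
      Finset.prod_nonneg fun _ _ => by positivity
    calc σe n / (n * log (log n))
        ≤ n * ((∏ p ∈ (⌊log (n : ℝ)⌋₊).primesLE, (1 + 1 / (p : ℝ))) * exp (1 / log (log n))) /
          (n * log (log n)) := by
          refine div_le_div_of_nonneg_right ?_ (by positivity)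
          exact (exponential_sigma_le h1 hm hpp hn0).2.trans (mul_le_mul_of_nonneg_left
            (prod_one_add_one_div_primeFactors_le hll (Finset.filter_subset _ _)) hn.le)
      _ = (∏ p ∈ (⌊log (n : ℝ)⌋₊).primesLE, (1 + 1 / (p : ℝ))) / log (log n) *
          exp (1 / log (log n)) := by
          rw [mul_div_mul_left _ _ hn.ne']
          ring
      _ ≤ _ := by
          refine mul_le_mul_of_nonneg_right ?_ (exp_pos _).le
          exact div_le_div_of_nonneg_left hP hlogfl hlogle
  have hnonneg : ∀ᶠ n : ℕ in atTop, 0 ≤ σe n / (n * log (log n)) := by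
    filter_upwards [hlarge] with n ⟨hll, hn0, _⟩
    exact div_nonneg (exponential_sigma_le h1 hm hpp hn0).1 (by positivity)
  have hbdd : IsBoundedUnder (· ≤ ·) atTop fun n : ℕ => σe n / (n * log (log n)) :=
    hU.isBoundedUnder_le.mono_le hle
  have hcobdd : IsCoboundedUnder (· ≤ ·) atTop fun n : ℕ => σe n / (n * log (log n)) :=
    (isBoundedUnder_of_eventually_ge hnonneg).isCoboundedUnder_le
  refine le_antisymm ?_ ?_
  · rw [← hU.limsup_eq]
    exact limsup_le_limsup hle hcobdd hU.isBoundedUnder_le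
  · refine le_of_forall_lt_imp_le_of_dense fun b hb => ?_
    refine le_limsup_of_frequently_le ?_ hbdd
    refine tendsto_primorial_sq_atTop.frequently (Eventually.frequently ?_)
    set c := log (2 * log 4)
    have hloglim : Tendsto (fun N : ℕ => log (N : ℝ)) atTop atTop :=
      Real.tendsto_log_atTop.comp tendsto_natCast_atTop_atTop
    have hratio : Tendsto (fun N : ℕ => (1 + c / log (N : ℝ))⁻¹) atTop (𝓝 1) := by
      have : Tendsto (fun N : ℕ => 1 + c / log (N : ℝ)) atTop (𝓝 1) := by
        simpa using (hloglim.const_div_atTop c).const_add 1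
      simpa using this.inv₀ one_ne_zero
    have hW := hM.mul hratio
    rw [mul_one] at hW
    filter_upwards [hW.eventually (lt_mem_nhds hb), eventually_ge_atTop 2,
      tendsto_primorial_sq_atTop.eventually hlarge] with N hbN hN ⟨hll, hn0, _⟩
    refine hbN.le.trans ?_
    have hn : ((primorial N ^ 2 : ℕ) : ℝ) ≠ 0 := by exact_mod_cast hn0
    have hN2 : (2 : ℝ) ≤ N := by exact_mod_cast hN
    have hlN : 0 < log (N : ℝ) := Real.log_pos (by linarith)
    have hl4 : 0 < log 4 := Real.log_pos (by norm_num)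
    have hlogpos : 0 < log ((primorial N ^ 2 : ℕ) : ℝ) := by
      refine lt_of_le_of_ne (Real.log_natCast_nonneg _) fun h => ?_
      rw [← h] at hll
      norm_num at hll
    have hup : log (log ((primorial N ^ 2 : ℕ) : ℝ)) ≤ c + log N := by
      rw [← Real.log_mul (by positivity) (by positivity)]
      exact Real.log_le_log hlogpos (log_primorial_sq_le N)
    rw [exponential_sigma_primorial_sq h1 hm hpp, mul_div_mul_left _ _ hn]
    have hP : 0 ≤ ∏ p ∈ N.primesLE, (1 + 1 / (p : ℝ)) :=
      Finset.prod_nonneg fun _ _ => by positivity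
    calc M N * (1 + c / log (N : ℝ))⁻¹
        = (∏ p ∈ N.primesLE, (1 + 1 / (p : ℝ))) / (c + log N) := by
          simp only [M]
          rw [← div_eq_mul_inv, div_div]
          congr 1
          field_simp
          ring
      _ ≤ _ := div_le_div_of_nonneg_left hP (by linarith) hup
end

section
/- Let A be a multiplicative divisor system such that for each prime p there exists an exponent e_p with p^{e_p}, p^{e_p − 1} ∈ A(p^{e_p}) and e_p = p^{o(1)}. Define σ_A(n) = ∑_{d ∈ A(n)} d. Then limsup_{n→∞} σ_A(n)/(n·log log n) = e^γ · ∏_p (1 − 1/p)·sup_{ν≥0} σ_A(p^ν)/p^ν, and this product converges. -/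
open Filter Real
open scoped Pointwise

section Mertens
open Finset Topology
open scoped ArithmeticFunction.vonMangoldt

theorem log_factorial (N : ℕ) : log (N.factorial) = ∑ n ∈ Ioc 0 N, log n := by
  induction N with
  | zero => simp
  | succ N ih =>
    rw [← Finset.insert_Ioc_right_eq_Ioc_add_one (by omega), sum_insert (by simp), ← ih,
      Nat.factorial_succ, Nat.cast_mul, Real.log_mul (by positivity) (by positivity)]

/-- Mertens' first theorem for the von Mangoldt function. -/
theorem abs_sum_vonMangoldt_div_sub_log_le {N : ℕ} (hN : N ≠ 0) :
    |∑ n ∈ Ioc 0 N, Λ n / n - log N| ≤ log 4 + 4 := by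
  have hN0 : (0 : ℝ) < N := by positivity
  have hfac : log (N.factorial) = ∑ n ∈ Ioc 0 N, Λ n * ((N / n : ℕ) : ℝ) := by
    rw [← ArithmeticFunction.sum_Ioc_mul_zeta_eq_sum, ArithmeticFunction.vonMangoldt_mul_zeta,
      log_factorial]
    rfl
  have hupper : log (N.factorial) ≤ N * ∑ n ∈ Ioc 0 N, Λ n / n := by
    rw [hfac, Finset.mul_sum]
    refine Finset.sum_le_sum fun n _ ↦ ?_
    calc Λ n * ((N / n : ℕ) : ℝ) ≤ Λ n * (N / n) :=
          mul_le_mul_of_nonneg_left Nat.cast_div_le ArithmeticFunction.vonMangoldt_nonneg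
      _ = N * (Λ n / n) := by ring
  have hlower : N * ∑ n ∈ Ioc 0 N, Λ n / n ≤ log (N.factorial) + (log 4 + 4) * N := by
    have hpsi := Chebyshev.psi_le_const_mul_self hN0.le
    rw [Chebyshev.psi, Nat.floor_natCast] at hpsi
    refine le_trans ?_ (add_le_add_right hpsi _)
    rw [hfac, Finset.mul_sum, ← Finset.sum_add_distrib]
    refine Finset.sum_le_sum fun n hn ↦ ?_
    have hlt : (N : ℝ) / n ≤ (N / n : ℕ) + 1 := by
      rw [← Nat.floor_div_eq_div (K := ℝ)]
      exact (Nat.lt_floor_add_one _).le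
    calc N * (Λ n / n) = Λ n * (N / n) := by ring
      _ ≤ Λ n * ((N / n : ℕ) + 1) :=
          mul_le_mul_of_nonneg_left hlt ArithmeticFunction.vonMangoldt_nonneg
      _ = _ := by ring
  have hfac_le : log (N.factorial) ≤ N * log N := by
    rw [← Real.log_pow]
    exact Real.log_le_log (by positivity) (mod_cast Nat.factorial_le_pow N)
  have hfac_ge : N * log N - N ≤ log (N.factorial) := by
    have h := Real.pow_div_factorial_le_exp N hN0.le N
    have h2 := Real.log_le_log (by positivity) h
    rw [Real.log_div (by positivity) (by positivity), Real.log_exp, Real.log_pow] at h2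
    linarith
  have h4 : 0 < log 4 := Real.log_pos (by norm_num)
  rw [abs_le]
  constructor <;> refine le_of_mul_le_mul_left ?_ hN0 <;> nlinarith

/-- The iterated logarithm is a discrete primitive of `1 / (n log n)` up to convergence. -/
theorem exists_tendsto_sum_inv_mul_log_sub_log_log :
    ∃ c : ℝ, Tendsto (fun N : ℕ ↦ ∑ n ∈ range N, 1 / (((n : ℝ) + 2) * log ((n : ℝ) + 2)) -
      log (log ((N : ℝ) + 2))) atTop (𝓝 c) := by
  have key (n : ℕ) : 1 / (((n : ℝ) + 1 + 2) * log ((n : ℝ) + 1 + 2)) ≤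
        log (log ((n : ℝ) + 1 + 2)) - log (log ((n : ℝ) + 2)) ∧
      log (log ((n : ℝ) + 1 + 2)) - log (log ((n : ℝ) + 2)) ≤
        1 / (((n : ℝ) + 2) * log ((n : ℝ) + 2)) := by
    have hx : (0 : ℝ) < (n : ℝ) + 2 := by positivity
    have hlx : 0 < log ((n : ℝ) + 2) := Real.log_pos (by linarith [n.cast_nonneg (α := ℝ)])
    have hly : 0 < log ((n : ℝ) + 1 + 2) := Real.log_pos (by linarith [n.cast_nonneg (α := ℝ)])
    have hd : log ((n : ℝ) + 1 + 2) - log ((n : ℝ) + 2) ≤ 1 / ((n : ℝ) + 2) := by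
      rw [← Real.log_div (by positivity) (by positivity)]
      refine (Real.log_le_sub_one_of_pos (by positivity)).trans_eq ?_
      field_simp
      ring
    have hd' : 1 / ((n : ℝ) + 1 + 2) ≤ log ((n : ℝ) + 1 + 2) - log ((n : ℝ) + 2) := by
      rw [← Real.log_div (by positivity) (by positivity)]
      refine le_trans (le_of_eq ?_) (Real.one_sub_inv_le_log_of_pos (by positivity))
      field_simp; ring
    rw [← Real.log_div hly.ne' hlx.ne']
    constructor
    · refine le_trans ?_ (Real.one_sub_inv_le_log_of_pos (by positivity))
      rw [← div_div, inv_div, one_sub_div hly.ne']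
      gcongr
    · refine (Real.log_le_sub_one_of_pos (by positivity)).trans ?_
      rw [← div_div, div_sub_one hlx.ne']
      gcongr
  refine ⟨_, tendsto_atTop_ciSup (monotone_nat_of_le_succ fun N ↦ ?_)
    ⟨1 / (2 * log 2) - log (log 2), ?_⟩⟩
  · rw [sum_range_succ]
    push_cast
    linarith [(key N).2]
  · rintro _ ⟨N, rfl⟩
    have (N : ℕ) : ∑ n ∈ range N, 1 / (((n : ℝ) + 2) * log ((n : ℝ) + 2)) -
      log (log ((N : ℝ) + 2)) ≤ 1 / (2 * log 2) - log (log 2) -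
        1 / (((N : ℝ) + 2) * log ((N : ℝ) + 2)) := by
      induction N with
      | zero => simp
      | succ N ih =>
        rw [sum_range_succ]
        push_cast
        linarith [(key N).1]
    refine (this N).trans ?_
    have : 0 ≤ log ((N : ℝ) + 2) := Real.log_nonneg (by linarith [N.cast_nonneg (α := ℝ)])
    have : 0 ≤ 1 / (((N : ℝ) + 2) * log ((N : ℝ) + 2)) := by positivity
    linarith

/-- A form of Mertens' second theorem, for the von Mangoldt function and without identification
of the constant. -/
theorem exists_tendsto_sum_vonMangoldt_div_log_sub_log_log :
    ∃ c : ℝ, Tendsto (fun N : ℕ ↦ ∑ n ∈ Ioc 0 N, Λ n / (n * log n) - log (log N))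
      atTop (𝓝 c) := by
  obtain ⟨c, hc⟩ := exists_tendsto_sum_inv_mul_log_sub_log_log
  let z (n : ℕ) : ℝ := Λ (n + 2) / ((n : ℝ) + 2) - 1 / ((n : ℝ) + 2)
  have hshift (f : ℕ → ℝ) (N : ℕ) : ∑ n ∈ range N, f (n + 2) + f 1 = ∑ n ∈ Ioc 0 (N + 1), f n := by
    induction N with
    | zero => simp
    | succ N ih => rw [sum_range_succ, ← Finset.insert_Ioc_right_eq_Ioc_add_one (by omega),
        sum_insert (by simp), ← ih]; ring_nf
  have hz (N : ℕ) : ‖∑ n ∈ range N, z n‖ ≤ log 4 + 6 := by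
    have h1 := abs_sum_vonMangoldt_div_sub_log_le (N := N + 1) (by omega)
    have h2 : ∑ n ∈ range N, Λ (n + 2) / ((n : ℝ) + 2) = ∑ n ∈ Ioc 0 (N + 1), Λ n / n := by
      rw [← hshift]; simp
    have h3 : ∑ n ∈ range N, 1 / ((n : ℝ) + 2) + 1 = harmonic (N + 1) := by
      rw [harmonic_eq_sum_Icc]
      push_cast
      have := hshift (fun n ↦ ((n : ℝ))⁻¹) N
      rw [← Finset.Icc_add_one_left_eq_Ioc] at this
      simpa using this
    have h4 := log_add_one_le_harmonic (N + 1)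
    have h5 := harmonic_le_one_add_log (N + 1)
    have h6 : log ((N + 1 : ℕ)) ≤ log ((N + 1 : ℕ) + 1) :=
      Real.log_le_log (by positivity) (by simp)
    have h7 : ∑ n ∈ range N, z n = ∑ n ∈ Ioc 0 (N + 1), Λ n / n - (harmonic (N + 1) - 1) := by
      rw [← h2, ← h3]; simp [z]
    rw [Real.norm_eq_abs, h7]
    rw [abs_le] at h1 ⊢
    push_cast at *
    constructor <;> linarith
  have hanti : Antitone fun n : ℕ ↦ 1 / log ((n : ℝ) + 2) := by
    intro a b hab
    have : 0 < log ((a : ℝ) + 2) := Real.log_pos (by linarith [a.cast_nonneg (α := ℝ)])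
    dsimp only
    gcongr
  have hzero : Tendsto (fun n : ℕ ↦ 1 / log ((n : ℝ) + 2)) atTop (𝓝 0) := by
    simp only [one_div]
    exact (Real.tendsto_log_atTop.comp
      (tendsto_atTop_add_const_right _ 2 tendsto_natCast_atTop_atTop)).inv_tendsto_atTop
  obtain ⟨d, hd⟩ := cauchySeq_tendsto_of_complete
    (hanti.cauchySeq_series_mul_of_tendsto_zero_of_bounded hzero hz)
  refine ⟨d + c, ?_⟩
  rw [← tendsto_add_atTop_iff_nat 2]
  have hterm : Tendsto (fun N : ℕ ↦ 1 / (((N : ℝ) + 2) * log ((N : ℝ) + 2))) atTop (𝓝 0) := by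
    have := (tendsto_inv_atTop_zero.comp
      (tendsto_atTop_add_const_right _ (2 : ℝ) tendsto_natCast_atTop_atTop)).mul hzero
    simpa [mul_inv_rev, mul_comm, Function.comp_def] using this
  have hd' := (hd.comp (tendsto_add_atTop_nat 1)).add (hc.add hterm)
  rw [add_zero] at hd'
  refine hd'.congr fun N ↦ ?_
  have h1 : ∑ n ∈ Ioc 0 (N + 2), Λ n / (n * log n) =
      ∑ n ∈ range (N + 1), Λ (n + 2) / (((n : ℝ) + 2) * log ((n : ℝ) + 2)) := by
    rw [← hshift]; simp
  have h2 : ∑ n ∈ range (N + 1), (1 / log ((n : ℝ) + 2)) • z n =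
      ∑ n ∈ range (N + 1), Λ (n + 2) / (((n : ℝ) + 2) * log ((n : ℝ) + 2)) -
      ∑ n ∈ range (N + 1), 1 / (((n : ℝ) + 2) * log ((n : ℝ) + 2)) := by
    rw [← Finset.sum_sub_distrib]
    refine Finset.sum_congr rfl fun n _ ↦ ?_
    have : log ((n : ℝ) + 2) ≠ 0 :=
      (Real.log_pos (by linarith [n.cast_nonneg (α := ℝ)])).ne'
    simp only [z, smul_eq_mul]
    field_simp
  rw [h1, Function.comp_apply, h2, sum_range_succ (fun n : ℕ ↦ 1 / (((n : ℝ) + 2) * _))]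
  push_cast
  ring

theorem vonMangoldt_div_log_nonneg (n : ℕ) : 0 ≤ Λ n / (n * log n) :=
  div_nonneg ArithmeticFunction.vonMangoldt_nonneg (by positivity)

theorem summable_vonMangoldt_div_log_mul_exp {s : ℝ} (hs : 0 < s) :
    Summable fun n : ℕ ↦ Λ n / (n * log n) * exp (-s * log n) := by
  refine Summable.of_nonneg_of_le
    (fun n ↦ mul_nonneg (vonMangoldt_div_log_nonneg n) (exp_pos _).le) (fun n ↦ ?_)
    (Real.summable_nat_rpow_inv.2 (show 1 < 1 + s by linarith))
  rcases n.eq_zero_or_pos with rfl | hn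
  · simp; positivity
  have hn' : (0 : ℝ) < n := by positivity
  rw [Real.rpow_add hn', Real.rpow_one, Real.rpow_def_of_pos hn', mul_inv, ← Real.exp_neg,
    mul_comm (log _) s, neg_mul]
  refine mul_le_mul_of_nonneg_right ?_ (exp_pos _).le
  rw [mul_comm, ← div_div, ← one_div]
  gcongr
  exact div_le_one_of_le₀ ArithmeticFunction.vonMangoldt_le_log (by positivity)

theorem tendsto_tsum_vonMangoldt_div_log_add_log :
    Tendsto (fun s : ℝ ↦ ∑' n : ℕ, Λ n / (n * log n) * exp (-s * log n) + log s)
      (𝓝[>] 0) (𝓝 0) := by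
  have h1 : Tendsto (fun s : ℝ ↦ ((1 + s : ℝ) : ℂ)) (𝓝[>] 0) (𝓝[≠] 1) := by
    refine tendsto_nhdsWithin_iff.2 ⟨?_, ?_⟩
    · have : ContinuousAt (fun s : ℝ ↦ ((1 + s : ℝ) : ℂ)) 0 := by fun_prop
      simpa using this.tendsto.mono_left nhdsWithin_le_nhds
    · filter_upwards [self_mem_nhdsWithin] with s hs
      have : s ≠ 0 := (Set.mem_Ioi.1 hs).ne'
      simpa using this
  have h2 := (Complex.continuous_re.tendsto _).comp (riemannZeta_residue_one.comp h1)
  have h3 : Tendsto (fun s : ℝ ↦ s * (riemannZeta ((1 + s : ℝ) : ℂ)).re) (𝓝[>] 0) (𝓝 1) := by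
    refine h2.congr fun s ↦ ?_
    simp
  have h4 := h3.log one_ne_zero
  rw [Real.log_one] at h4
  refine h4.congr' ?_
  filter_upwards [self_mem_nhdsWithin, h3.eventually_ne one_ne_zero] with s hs hne
  rw [Real.log_mul (left_ne_zero_of_mul hne) (right_ne_zero_of_mul hne), add_comm,
    log_riemannZeta_eq (by simpa using hs)]
  congr 2
  ext n
  rcases n.eq_zero_or_pos with rfl | hn
  · simp
  have hn' : (0 : ℝ) < n := by positivity
  rw [Real.rpow_add hn', Real.rpow_one, Real.rpow_def_of_pos hn', neg_mul, Real.exp_neg,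
    mul_comm (log _) s]
  field_simp

theorem sum_range_sum_ceil_log (M : ℕ) :
    ∑ m ∈ range (M + 1), ∑ n ∈ range (⌊exp m⌋₊ + 1) with ⌈log (n : ℕ)⌉₊ = m, Λ n / (n * log n) =
      ∑ n ∈ Ioc 0 ⌊exp M⌋₊, Λ n / (n * log n) := by
  have hle {n m : ℕ} (h : ⌈log n⌉₊ ≤ m) : n < ⌊exp m⌋₊ + 1 := by
    rcases n.eq_zero_or_pos with rfl | hn
    · simp
    · rw [Nat.lt_succ_iff, Nat.le_floor_iff (exp_pos _).le,
        ← Real.log_le_iff_le_exp (by positivity)]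
      exact Nat.ceil_le.1 h
  have hge {n m : ℕ} (h : n < ⌊exp m⌋₊ + 1) : ⌈log n⌉₊ ≤ m := by
    rcases n.eq_zero_or_pos with rfl | hn
    · simp
    · rw [Nat.lt_succ_iff, Nat.le_floor_iff (exp_pos _).le,
        ← Real.log_le_iff_le_exp (by positivity)] at h
      exact Nat.ceil_le.2 h
  have h1 : ∑ n ∈ Ioc 0 ⌊exp M⌋₊, Λ n / (n * log n) =
      ∑ n ∈ range (⌊exp M⌋₊ + 1), Λ n / (n * log n) := by
    refine sum_subset (fun n hn ↦ ?_) (fun n hn hn' ↦ ?_)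
    · simp at hn ⊢; omega
    · have : n = 0 := by simp at hn hn'; omega
      simp [this]
  rw [h1, ← sum_fiberwise_of_maps_to (s := range (⌊exp M⌋₊ + 1)) (g := fun n : ℕ ↦ ⌈log n⌉₊)
    (t := range (M + 1))]
  · refine sum_congr rfl fun m hm ↦ sum_congr ?_ fun _ _ ↦ rfl
    ext n
    simp only [mem_filter, mem_range, and_congr_left_iff] at hm ⊢
    intro h
    exact ⟨fun _ ↦ hle (by omega), fun _ ↦ hle (by omega)⟩
  · intro n hn
    have := hge (m := M) (mem_range.1 hn)
    simp only [mem_range]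
    omega

theorem hasSum_sum_ceil_log {s : ℝ} (hs : 0 < s) :
    Summable (fun n : ℕ ↦ Λ n / (n * log n) * exp (-s * ⌈log n⌉₊)) ∧
    HasSum (fun m : ℕ ↦
      (∑ n ∈ range (⌊exp m⌋₊ + 1) with ⌈log (n : ℕ)⌉₊ = m, Λ n / (n * log n)) * exp (-s) ^ m)
      (∑' n : ℕ, Λ n / (n * log n) * exp (-s * ⌈log n⌉₊)) := by
  have hsum : Summable (fun n : ℕ ↦ Λ n / (n * log n) * exp (-s * ⌈log n⌉₊)) := by
    refine Summable.of_nonneg_of_le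
      (fun n ↦ mul_nonneg (vonMangoldt_div_log_nonneg n) (exp_pos _).le) (fun n ↦ ?_)
      (summable_vonMangoldt_div_log_mul_exp hs)
    refine mul_le_mul_of_nonneg_left (exp_le_exp.2 ?_) (vonMangoldt_div_log_nonneg n)
    nlinarith [Nat.le_ceil (log n)]
  refine ⟨hsum, ?_⟩
  refine (hsum.hasSum.tsum_fiberwise (fun n : ℕ ↦ ⌈log n⌉₊)).congr_fun fun m ↦ ?_
  rw [tsum_subtype ((fun n : ℕ ↦ ⌈log n⌉₊) ⁻¹' {m})
    (fun n : ℕ ↦ Λ n / (n * log n) * exp (-s * ⌈log n⌉₊)), sum_filter, sum_mul,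
    tsum_eq_sum (s := range (⌊exp m⌋₊ + 1))]
  · refine sum_congr rfl fun n _ ↦ ?_
    by_cases h : ⌈log n⌉₊ = m
    · have : n ∈ (fun n : ℕ ↦ ⌈log n⌉₊) ⁻¹' {m} := h
      rw [if_pos h, Set.indicator_of_mem this, h, ← Real.exp_nat_mul, mul_comm (m : ℝ)]
    · have : n ∉ (fun n : ℕ ↦ ⌈log n⌉₊) ⁻¹' {m} := h
      rw [if_neg h, Set.indicator_of_notMem this, zero_mul]
  · intro n hn
    refine Set.indicator_of_notMem (s := (fun n : ℕ ↦ ⌈log n⌉₊) ⁻¹' {m})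
      (fun h : ⌈log n⌉₊ = m ↦ hn ?_) _
    rcases n.eq_zero_or_pos with rfl | hn
    · simp
    · rw [mem_range, Nat.lt_succ_iff, Nat.le_floor_iff (exp_pos _).le,
        ← Real.log_le_iff_le_exp (by positivity)]
      exact Nat.ceil_le.1 h.le

theorem tendsto_log_log_floor_exp_sub_log :
    Tendsto (fun M : ℕ ↦ log (log (⌊exp M⌋₊ : ℕ)) - log M) atTop (𝓝 0) := by
  have h : Tendsto (fun M : ℕ ↦ log (⌊exp M⌋₊ : ℕ) / M) atTop (𝓝 1) := by
    have h1 : Tendsto (fun M : ℕ ↦ 1 - 1 / (M : ℝ)) atTop (𝓝 1) := by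
      simpa using tendsto_const_nhds.sub (tendsto_one_div_atTop_nhds_zero_nat (𝕜 := ℝ))
    refine tendsto_of_tendsto_of_tendsto_of_le_of_le' h1 tendsto_const_nhds ?_ ?_
    · filter_upwards [eventually_ge_atTop 1] with M hM
      have hM' : (1 : ℝ) ≤ M := by exact_mod_cast hM
      rw [one_sub_div (by positivity)]
      gcongr
      have h2 := Nat.sub_one_lt_floor (exp (M : ℝ))
      have h3 : exp ((M : ℝ) - 1) ≤ exp M - 1 := by
        have h5 : exp (M : ℝ) = exp ((M : ℝ) - 1) * exp 1 := by rw [← Real.exp_add]; simp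
        have h6 := Real.add_one_le_exp (1 : ℝ)
        have h7 := Real.add_one_le_exp ((M : ℝ) - 1)
        nlinarith
      rw [Real.le_log_iff_exp_le (by linarith [exp_pos ((M : ℝ) - 1)])]
      linarith
    · filter_upwards [eventually_ge_atTop 1] with M hM
      have hM' : (1 : ℝ) ≤ M := by exact_mod_cast hM
      refine div_le_one_of_le₀ ?_ (by positivity)
      rw [Real.log_le_iff_le_exp]
      · exact Nat.floor_le (exp_pos _).le
      · exact_mod_cast Nat.floor_pos.2 (Real.one_le_exp (by positivity))
  have h' := h.log one_ne_zero
  rw [Real.log_one] at h'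
  refine h'.congr' ?_
  filter_upwards [h.eventually_ne one_ne_zero] with M hM
  rw [Real.log_div (fun h ↦ hM (by simp [h])) (fun h ↦ hM (by simp [h]))]

theorem tendsto_log_one_sub_exp_neg_sub_log :
    Tendsto (fun s : ℝ ↦ log (1 - exp (-s)) - log s) (𝓝[>] 0) (𝓝 0) := by
  have h : HasDerivAt (fun s : ℝ ↦ 1 - exp (-s)) 1 0 := by
    simpa using ((hasDerivAt_neg (0 : ℝ)).exp).const_sub 1
  have h1 := (hasDerivAt_iff_tendsto_slope.1 h).mono_left
    (nhdsWithin_mono 0 (fun s (hs : 0 < s) ↦ hs.ne'))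
  have h2 := h1.log one_ne_zero
  rw [Real.log_one] at h2
  refine h2.congr' ?_
  filter_upwards [self_mem_nhdsWithin] with s hs
  have hs : 0 < s := hs
  have : exp (-s) < 1 := by simpa using hs
  rw [slope_def_field, Real.log_div] <;> simp <;> linarith

/-- Mertens' second theorem for the von Mangoldt function, with its constant. -/
theorem tendsto_sum_vonMangoldt_div_log_sub_log_log :
    Tendsto (fun N : ℕ ↦ ∑ n ∈ Ioc 0 N, Λ n / (n * log n) - log (log N))
      atTop (𝓝 eulerMascheroniConstant) := by
  obtain ⟨c, hc⟩ := exists_tendsto_sum_vonMangoldt_div_log_sub_log_log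
  suffices c = eulerMascheroniConstant by rwa [← this]
  set W : ℕ → ℝ := fun m ↦
    ∑ n ∈ range (⌊exp m⌋₊ + 1) with ⌈log (n : ℕ)⌉₊ = m, Λ n / (n * log n) with hW
  have hpartial : Tendsto (fun M ↦ ∑ m ∈ range M, (W m - 1 / m)) atTop
      (𝓝 (c - eulerMascheroniConstant)) := by
    rw [← tendsto_add_atTop_iff_nat 1]
    have hexp : Tendsto (fun M : ℕ ↦ ⌊exp M⌋₊) atTop atTop :=
      tendsto_nat_floor_atTop.comp (tendsto_exp_atTop.comp tendsto_natCast_atTop_atTop)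
    have := ((hc.comp hexp).add tendsto_log_log_floor_exp_sub_log).sub tendsto_harmonic_sub_log
    rw [add_zero] at this
    refine this.congr fun M ↦ ?_
    have hh : ∑ m ∈ range (M + 1), 1 / (m : ℝ) = harmonic M := by
      rw [sum_range_succ', harmonic]; simp
    rw [sum_sub_distrib, hh, hW, sum_range_sum_ceil_log]
    simp only [Function.comp_apply]
    ring
  have habel := Real.tendsto_tsum_powerSeries_nhdsWithin_lt hpartial
  have hexp : Tendsto (fun s : ℝ ↦ exp (-s)) (𝓝[>] 0) (𝓝[<] 1) := by
    refine tendsto_nhdsWithin_iff.2 ⟨?_, ?_⟩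
    · have : ContinuousAt (fun s : ℝ ↦ exp (-s)) 0 := by fun_prop
      simpa using this.tendsto.mono_left nhdsWithin_le_nhds
    · filter_upwards [self_mem_nhdsWithin] with s hs
      simpa using hs
  set G : ℝ → ℝ := fun s ↦ ∑' n : ℕ, Λ n / (n * log n) * exp (-s * ⌈log n⌉₊) with hG
  set F : ℝ → ℝ := fun s ↦ ∑' n : ℕ, Λ n / (n * log n) * exp (-s * log n) with hF
  have h1 : Tendsto (fun s : ℝ ↦ G s + log (1 - exp (-s))) (𝓝[>] 0)
      (𝓝 (c - eulerMascheroniConstant)) := by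
    refine (habel.comp hexp).congr' ?_
    filter_upwards [self_mem_nhdsWithin] with s hs
    have hs : 0 < s := hs
    have hlt : |exp (-s)| < 1 := by rw [abs_of_pos (exp_pos _)]; simpa using hs
    have hl : HasSum (fun m : ℕ ↦ 1 / (m : ℝ) * exp (-s) ^ m) (-log (1 - exp (-s))) := by
      rw [← hasSum_nat_add_iff' 1]
      simpa [div_eq_inv_mul] using hasSum_pow_div_log_of_abs_lt_one hlt
    have := ((hasSum_sum_ceil_log hs).2.sub hl).tsum_eq
    rw [sub_neg_eq_add] at this
    rw [hG, ← this, Function.comp_apply]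
    simp only [sub_mul, hW]
  have hFlog : Tendsto (fun s ↦ F s + log s) (𝓝[>] 0) (𝓝 0) :=
    tendsto_tsum_vonMangoldt_div_log_add_log
  have hid : Tendsto (fun s : ℝ ↦ s) (𝓝[>] 0) (𝓝 0) := tendsto_nhdsWithin_of_tendsto_nhds tendsto_id
  have hslog : Tendsto (fun s : ℝ ↦ s * F s) (𝓝[>] 0) (𝓝 0) := by
    have h2 : Tendsto (fun s : ℝ ↦ log s * s) (𝓝[>] 0) (𝓝 0) := by
      simpa using tendsto_log_mul_rpow_nhdsGT_zero (r := 1) one_pos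
    have := (hid.mul hFlog).sub h2
    simp only [mul_zero, sub_zero] at this
    refine this.congr fun s ↦ ?_
    ring
  have h2 : Tendsto (fun s : ℝ ↦ G s + log s) (𝓝[>] 0) (𝓝 0) := by
    have hlow := hFlog.sub hslog
    rw [sub_zero] at hlow
    refine tendsto_of_tendsto_of_tendsto_of_le_of_le' hlow hFlog ?_ ?_
    · filter_upwards [self_mem_nhdsWithin] with s hs
      have hs : 0 < s := hs
      have hF0 : 0 ≤ F s :=
        tsum_nonneg fun n ↦ mul_nonneg (vonMangoldt_div_log_nonneg n) (exp_pos _).le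
      have : exp (-s) * F s ≤ G s := by
        rw [hF, ← tsum_mul_left]
        refine Summable.tsum_le_tsum (fun n ↦ ?_)
          ((summable_vonMangoldt_div_log_mul_exp hs).mul_left _) (hasSum_sum_ceil_log hs).1
        rw [mul_left_comm, ← Real.exp_add]
        refine mul_le_mul_of_nonneg_left (exp_le_exp.2 ?_) (vonMangoldt_div_log_nonneg n)
        nlinarith [Nat.ceil_lt_add_one (Real.log_natCast_nonneg n)]
      nlinarith [Real.add_one_le_exp (-s)]
    · filter_upwards [self_mem_nhdsWithin] with s hs
      have hs : 0 < s := hs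
      refine add_le_add_left ?_ _
      refine Summable.tsum_le_tsum (fun n ↦ ?_) (hasSum_sum_ceil_log hs).1
        (summable_vonMangoldt_div_log_mul_exp hs)
      refine mul_le_mul_of_nonneg_left (exp_le_exp.2 ?_) (vonMangoldt_div_log_nonneg n)
      nlinarith [Nat.le_ceil (log n)]
  have h3 := h2.add tendsto_log_one_sub_exp_neg_sub_log
  have h4 : Tendsto (fun s : ℝ ↦ G s + log (1 - exp (-s))) (𝓝[>] 0) (𝓝 (0 + 0)) :=
    h3.congr fun s ↦ by ring
  have := tendsto_nhds_unique h1 h4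
  linarith

theorem summable_not_prime_vonMangoldt_div_log :
    Summable fun n : ℕ ↦ if n.Prime then 0 else Λ n / (n * log n) := by
  have h := (ArithmeticFunction.vonMangoldt.summable_residueClass_non_primes_div
    (1 : ZMod 1)).mul_left (1 / log 2)
  refine Summable.of_nonneg_of_le (fun n ↦ ?_) (fun n ↦ ?_) h
  · split_ifs
    exacts [le_rfl, vonMangoldt_div_log_nonneg n]
  · have hmem : n ∈ {n : ℕ | (n : ZMod 1) = 1} := Subsingleton.elim _ _
    rw [ArithmeticFunction.vonMangoldt.residueClass, Set.indicator_of_mem hmem]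
    split_ifs with hp
    · simp
    · rcases lt_or_ge n 2 with hn | hn
      · interval_cases n <;> simp
      · have h2 : (2 : ℝ) ≤ n := by exact_mod_cast hn
        have : 0 < log 2 := Real.log_pos (by norm_num)
        rw [div_mul_div_comm, one_mul, mul_comm (log 2)]
        have := ArithmeticFunction.vonMangoldt_nonneg (n := n)
        gcongr

theorem neg_log_one_sub_sub_bounds {p : ℕ} (hp : p.Prime) :
    0 ≤ -log (1 - 1 / (p : ℝ)) - 1 / p ∧ -log (1 - 1 / (p : ℝ)) - 1 / p ≤ 2 * (1 / (p : ℝ) ^ 2) := by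
  have h2 : (2 : ℝ) ≤ p := by exact_mod_cast hp.two_le
  have hx : 1 / (p : ℝ) ≤ 1 / 2 := by gcongr
  have hx0 : 0 < 1 / (p : ℝ) := by positivity
  rw [← one_div_pow]
  set x := 1 / (p : ℝ)
  have h1 := Real.log_le_sub_one_of_pos (show 0 < 1 - x by linarith)
  have h3 := Real.one_sub_inv_le_log_of_pos (show 0 < 1 - x by linarith)
  refine ⟨by linarith, ?_⟩
  have h4 : (1 - x)⁻¹ ≤ 1 + x + 2 * x ^ 2 := by
    rw [inv_le_iff_one_le_mul₀ (by linarith)]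
    nlinarith [mul_nonneg hx0.le hx0.le, mul_nonneg (mul_nonneg hx0.le hx0.le) hx0.le,
      mul_nonneg (mul_nonneg hx0.le hx0.le) (sub_nonneg.2 hx)]
  linarith

theorem hasSum_neg_log_one_sub_sub :
    HasSum (fun n : ℕ ↦ if n.Prime then -log (1 - 1 / (n : ℝ)) - 1 / n else 0)
      (∑' n : ℕ, if n.Prime then 0 else Λ n / (n * log n)) := by
  have hsum : Summable (fun n : ℕ ↦ if n.Prime then -log (1 - 1 / (n : ℝ)) - 1 / n else 0) := by
    refine Summable.of_nonneg_of_le (fun n ↦ ?_) (fun n ↦ ?_)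
      ((Real.summable_one_div_nat_pow.2 one_lt_two).mul_left 2)
    · split_ifs with hp
      exacts [(neg_log_one_sub_sub_bounds hp).1, le_rfl]
    · split_ifs with hp
      · exact (neg_log_one_sub_sub_bounds hp).2
      · positivity
  convert hsum.hasSum using 1
  rw [tsum_eq_tsum_primes_add_tsum_primes_of_support_subset_prime_powers
    summable_not_prime_vonMangoldt_div_log]
  · have h0 : ∑' p : Nat.Primes, (if (p : ℕ).Prime then 0 else Λ p / ((p : ℕ) * log (p : ℕ))) = 0 :=
      (tsum_congr fun p ↦ if_pos p.2).trans tsum_zero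
    rw [h0, zero_add]
    have h1 (p : Nat.Primes) : ∑' k : ℕ, (if ((p : ℕ) ^ (k + 2)).Prime then 0 else
        Λ ((p : ℕ) ^ (k + 2)) / (((p : ℕ) ^ (k + 2) : ℕ) * log ((p : ℕ) ^ (k + 2) : ℕ))) =
        -log (1 - 1 / ((p : ℕ) : ℝ)) - 1 / ((p : ℕ) : ℝ) := by
      have hp : (1 : ℝ) < (p : ℕ) := by exact_mod_cast p.2.one_lt
      have hlt : |1 / ((p : ℕ) : ℝ)| < 1 := by
        rw [abs_of_pos (by positivity), div_lt_one (by positivity)]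
        exact hp
      have := (hasSum_nat_add_iff' 1).2 (hasSum_pow_div_log_of_abs_lt_one hlt)
      simp only [range_one, sum_singleton, zero_add, pow_one, Nat.cast_zero, div_one] at this
      rw [← this.tsum_eq]
      refine tsum_congr fun k ↦ ?_
      have hlog : log (p : ℕ) ≠ 0 := (Real.log_pos hp).ne'
      rw [if_neg (Nat.Prime.not_prime_pow (by omega)),
        ArithmeticFunction.vonMangoldt_apply_pow (by omega),
        ArithmeticFunction.vonMangoldt_apply_prime p.2]
      push_cast
      rw [Real.log_pow, one_div, inv_pow]
      push_cast
      field_simp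
      ring
    rw [tsum_congr h1]
    rw [← tsum_subtype_eq_of_support_subset (s := {p : ℕ | p.Prime})
      (f := fun n : ℕ ↦ if n.Prime then -log (1 - 1 / (n : ℝ)) - 1 / n else 0)]
    · refine tsum_congr fun p ↦ ?_
      rw [if_pos p.2]
    · intro n hn
      by_contra h
      exact hn (if_neg h)
  · intro n hn
    rw [Function.mem_support] at hn
    refine ArithmeticFunction.vonMangoldt_ne_zero_iff.1 fun h ↦ hn ?_
    simp [h]

/-- Mertens' third theorem. -/
theorem tendsto_prod_primesLE_inv_div_log :
    Tendsto (fun N : ℕ ↦ (∏ p ∈ Nat.primesLE N, (1 - 1 / (p : ℝ))⁻¹) / log N) atTop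
      (𝓝 (exp eulerMascheroniConstant)) := by
  have hIoc {f : ℕ → ℝ} {a : ℝ} (hf : HasSum f a) (h0 : f 0 = 0) :
      Tendsto (fun N : ℕ ↦ ∑ n ∈ Ioc 0 N, f n) atTop (𝓝 a) := by
    refine (hf.tendsto_sum_nat.comp (tendsto_add_atTop_nat 1)).congr fun N ↦ ?_
    rw [Function.comp_apply, Finset.range_eq_Ico, Finset.sum_eq_sum_Ico_succ_bot (by omega), h0,
      zero_add]
    rfl
  have h := (tendsto_sum_vonMangoldt_div_log_sub_log_log.sub
    (hIoc summable_not_prime_vonMangoldt_div_log.hasSum (by simp))).add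
    (hIoc hasSum_neg_log_one_sub_sub (by simp))
  rw [sub_add_cancel] at h
  refine ((continuous_exp.tendsto _).comp h).congr' ?_
  filter_upwards [eventually_gt_atTop 1] with N hN
  have hN' : (1 : ℝ) < N := by exact_mod_cast hN
  have hpos {p : ℕ} (hp : p.Prime) : 0 < 1 - 1 / (p : ℝ) := by
    have : (1 : ℝ) < p := by exact_mod_cast hp.one_lt
    rw [sub_pos, div_lt_one (by positivity)]
    exact this
  have hsum : ∑ n ∈ Ioc 0 N, Λ n / (n * log n) - log (log N) -
      ∑ n ∈ Ioc 0 N, (if n.Prime then 0 else Λ n / (n * log n)) +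
      ∑ n ∈ Ioc 0 N, (if n.Prime then -log (1 - 1 / (n : ℝ)) - 1 / n else 0) =
      ∑ p ∈ Nat.primesLE N, -log (1 - 1 / (p : ℝ)) - log (log N) := by
    rw [sub_right_comm, ← sum_sub_distrib, sub_add_eq_add_sub, ← sum_add_distrib,
      Nat.primesLE_eq_filter_Ioc_zero, sum_filter]
    congr 1
    refine sum_congr rfl fun n _ ↦ ?_
    split_ifs with hp
    · have : log n ≠ 0 := (Real.log_pos (by exact_mod_cast hp.one_lt)).ne'
      rw [ArithmeticFunction.vonMangoldt_apply_prime hp]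
      field_simp
      ring
    · ring
  rw [Function.comp_apply, hsum, Real.exp_sub, Real.exp_sum, Real.exp_log (Real.log_pos hN')]
  congr 1
  refine prod_congr rfl fun p hp ↦ ?_
  rw [Real.exp_neg, Real.exp_log (hpos (Nat.prime_of_mem_primesLE hp))]

end Mertens

section MultiplicativeRatio
open Finset Topology

theorem one_sub_sum_le_prod_one_sub {ι : Type*} (s : Finset ι) (f : ι → ℝ)
    (h0 : ∀ i ∈ s, 0 ≤ f i) (h1 : ∀ i ∈ s, f i ≤ 1) :
    1 - ∑ i ∈ s, f i ≤ ∏ i ∈ s, (1 - f i) := by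
  classical
  induction s using Finset.induction_on with
  | empty => simp
  | insert i s hi ih =>
    rw [sum_insert hi, prod_insert hi]
    have ih' := ih (fun j hj ↦ h0 j (mem_insert_of_mem hj)) fun j hj ↦ h1 j (mem_insert_of_mem hj)
    have hs := sum_nonneg fun j hj ↦ h0 j (mem_insert_of_mem (a := j) (b := i) (s := s) hj)
    have hi0 := h0 i (mem_insert_self i s)
    have hi1 := h1 i (mem_insert_self i s)
    nlinarith [mul_le_mul_of_nonneg_left ih' (sub_nonneg.2 hi1), mul_nonneg hi0 hs]

theorem tendsto_prod_primesLE {a : ℕ → ℝ} (h : Multipliable fun p : Nat.Primes ↦ a p) :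
    Tendsto (fun N ↦ ∏ p ∈ Nat.primesLE N, a p) atTop (𝓝 (∏' p : Nat.Primes, a p)) := by
  have h1 : HasProd ({p : ℕ | p.Prime}.mulIndicator a) (∏' p : Nat.Primes, a p) :=
    hasProd_subtype_iff_mulIndicator.1 h.hasProd
  refine (h1.tendsto_prod_nat.comp (tendsto_add_atTop_nat 1)).congr fun N ↦ ?_
  rw [Nat.primesLE_eq_filter_range, prod_filter]
  simp [Set.mulIndicator_apply]

/-- The properties of `n ↦ σ_A(n) / n` which hold for every multiplicative divisor system `A`. -/
structure IsDivisorSumRatio (r : ℕ → ℝ) : Prop where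
  nonneg : ∀ n, 0 ≤ r n
  map_one : r 1 = 1
  map_mul : ∀ m n, Nat.Coprime m n → r (m * n) = r m * r n
  map_prime_pow_le : ∀ p ν : ℕ, p.Prime → r (p ^ ν) ≤ (1 - 1 / (p : ℝ))⁻¹

namespace IsDivisorSumRatio

variable {r : ℕ → ℝ}

theorem bddAbove_range (hr : IsDivisorSumRatio r) {p : ℕ} (hp : p.Prime) :
    BddAbove (Set.range fun ν ↦ r (p ^ ν)) :=
  ⟨_, Set.forall_mem_range.2 fun ν ↦ hr.map_prime_pow_le p ν hp⟩

theorem le_iSup (hr : IsDivisorSumRatio r) {p : ℕ} (hp : p.Prime) (ν : ℕ) :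
    r (p ^ ν) ≤ ⨆ ν, r (p ^ ν) :=
  le_ciSup (hr.bddAbove_range hp) ν

theorem iSup_le (hr : IsDivisorSumRatio r) {p : ℕ} (hp : p.Prime) :
    ⨆ ν, r (p ^ ν) ≤ (1 - 1 / (p : ℝ))⁻¹ :=
  ciSup_le fun ν ↦ hr.map_prime_pow_le p ν hp

theorem one_sub_inv_pos {p : ℕ} (hp : p.Prime) : 0 < 1 - 1 / (p : ℝ) := by
  have : (1 : ℝ) < p := by exact_mod_cast hp.one_lt
  rw [sub_pos, div_lt_one] <;> linarith

/-- The local factor at `p` of the constant in the limsup formula. -/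
noncomputable def localFactor (r : ℕ → ℝ) (p : ℕ) : ℝ :=
  (1 - 1 / (p : ℝ)) * ⨆ ν, r (p ^ ν)

theorem localFactor_le_one (hr : IsDivisorSumRatio r) {p : ℕ} (hp : p.Prime) :
    localFactor r p ≤ 1 := by
  have h := mul_le_mul_of_nonneg_left (hr.iSup_le hp) (one_sub_inv_pos hp).le
  rwa [mul_inv_cancel₀ (one_sub_inv_pos hp).ne'] at h

theorem multipliable_localFactor (hr : IsDivisorSumRatio r) {e : ℕ → ℕ}
    (he : ∀ p : ℕ, p.Prime → 1 + 1 / (p : ℝ) ≤ r (p ^ e p)) :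
    Multipliable fun p : Nat.Primes ↦ localFactor r p := by
  have hs : Summable fun p : Nat.Primes ↦ ‖localFactor r p - 1‖ := by
    have h2 : Summable fun n : ℕ ↦ 1 / (n : ℝ) ^ 2 := Real.summable_one_div_nat_pow.2 one_lt_two
    refine Summable.of_nonneg_of_le (fun _ ↦ norm_nonneg _) (fun p ↦ ?_)
      (h2.comp_injective (Subtype.val_injective (p := Nat.Prime)))
    have hl := mul_le_mul_of_nonneg_left ((he p p.2).trans (hr.le_iSup p.2 _))
      (one_sub_inv_pos p.2).le
    have hu := hr.localFactor_le_one p.2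
    have hsq : (1 - 1 / (p : ℝ)) * (1 + 1 / (p : ℝ)) = 1 - 1 / (p : ℝ) ^ 2 := by ring
    rw [norm_eq_abs, abs_of_nonpos (by linarith)]
    change -(localFactor r p - 1) ≤ 1 / ((p : ℕ) : ℝ) ^ 2
    rw [hsq] at hl
    change _ ≤ localFactor r p at hl
    linarith
  refine (multipliable_one_add_of_summable hs).congr fun p ↦ ?_
  ring

theorem le_prod_mul_exp (hr : IsDivisorSumRatio r) {n : ℕ} (hn : 1 < log n) :
    r n ≤ (∏ p ∈ Nat.primesLE ⌊log n⌋₊, ⨆ ν, r (p ^ ν)) *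
      exp (log n / log (log n) / (log n - 1)) := by
  set L := log n with hL
  set T := n.primeFactors \ Nat.primesLE ⌊L⌋₊ with hT
  have hn0 : n ≠ 0 := by rintro rfl; simp at hL; linarith
  have hTp : ∀ p ∈ T, p.Prime ∧ L < p := fun p hp ↦ by
    rw [hT, Finset.mem_sdiff, Nat.mem_primesLE, Nat.mem_primeFactors] at hp
    exact ⟨hp.1.1, (Nat.floor_lt (by linarith)).1 (not_le.1 fun h ↦ hp.2 ⟨h, hp.1.1⟩)⟩
  have hfac : r n = (∏ p ∈ Nat.primesLE ⌊L⌋₊, r (p ^ n.factorization p)) *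
      ∏ p ∈ T, r (p ^ n.factorization p) := by
    rw [Nat.multiplicative_factorization r hr.map_mul hr.map_one hn0,
      Finsupp.prod_of_support_subset _ (s := Nat.primesLE ⌊L⌋₊ ∪ n.primeFactors)
        subset_union_right _ (fun p _ ↦ by simp [hr.map_one]),
      ← union_sdiff_self_eq_union, prod_union disjoint_sdiff]
  have hcard : (#T : ℝ) ≤ L / log L := by
    rw [le_div_iff₀ (log_pos hn), ← nsmul_eq_mul]
    calc #T • log L ≤ ∑ p ∈ T, log (p : ℝ) :=
          card_nsmul_le_sum _ _ _ fun p hp ↦ log_le_log (by linarith) (hTp p hp).2.le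
      _ = log ((∏ p ∈ T, p : ℕ) : ℝ) := by
          rw [Nat.cast_prod, log_prod fun p hp ↦ Nat.cast_ne_zero.2 (hTp p hp).1.ne_zero]
      _ ≤ L := by
          have hpos : 0 < ∏ p ∈ T, p := prod_pos fun p hp ↦ (hTp p hp).1.pos
          refine log_le_log (by exact_mod_cast hpos) (Nat.cast_le.2 (Nat.le_of_dvd hn0.bot_lt ?_))
          exact (prod_dvd_prod_of_subset _ _ _ sdiff_subset).trans (Nat.prod_primeFactors_dvd n)
  rw [hfac]
  gcongr with p hp p hp
  · exact prod_nonneg fun p _ ↦ hr.nonneg _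
  · exact prod_nonneg fun p hp ↦
      (hr.nonneg _).trans (hr.le_iSup (Nat.mem_primesLE.1 hp).2 0)
  · exact fun p _ ↦ hr.nonneg _
  · exact hr.le_iSup (Nat.mem_primesLE.1 hp).2 _
  calc ∏ p ∈ T, r (p ^ n.factorization p) ≤ ∏ p ∈ T, exp (1 / (L - 1)) := by
        refine prod_le_prod (fun p _ ↦ hr.nonneg _) fun p hp ↦ ?_
        obtain ⟨hpp, hpL⟩ := hTp p hp
        refine (hr.map_prime_pow_le p _ hpp).trans ?_
        have : (1 - 1 / (p : ℝ))⁻¹ = 1 / (p - 1) + 1 := by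
          have : (p : ℝ) - 1 ≠ 0 := by linarith
          have : (p : ℝ) ≠ 0 := by linarith
          field_simp
          ring
        rw [this]
        refine le_trans ?_ (add_one_le_exp _)
        gcongr
    _ = exp (#T * (1 / (L - 1))) := by rw [prod_const, exp_nat_mul]
    _ ≤ _ := by
        rw [exp_le_exp, mul_one_div]
        gcongr

theorem prod_localFactor_mul (s : Finset ℕ) (hs : ∀ p ∈ s, p.Prime) :
    (∏ p ∈ s, localFactor r p) * ∏ p ∈ s, (1 - 1 / (p : ℝ))⁻¹ =
      ∏ p ∈ s, ⨆ ν, r (p ^ ν) := by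
  rw [← prod_mul_distrib]
  refine prod_congr rfl fun p hp ↦ ?_
  have := (one_sub_inv_pos (hs p hp)).ne'
  rw [localFactor, mul_right_comm, mul_inv_cancel₀ this, one_mul]

theorem exists_tendsto_of_eventually_le (hr : IsDivisorSumRatio r)
    (hm : Multipliable fun p : Nat.Primes ↦ localFactor r p) :
    ∃ u : ℕ → ℝ, (∀ᶠ n : ℕ in atTop, r n / log (log n) ≤ u n) ∧
      Tendsto u atTop
        (𝓝 (exp eulerMascheroniConstant * ∏' p : Nat.Primes, localFactor r p)) := by
  have hlog : Tendsto (fun n : ℕ ↦ log (n : ℝ)) atTop atTop :=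
    tendsto_log_atTop.comp tendsto_natCast_atTop_atTop
  have hfloor : Tendsto (fun n : ℕ ↦ ⌊log (n : ℝ)⌋₊) atTop atTop :=
    tendsto_nat_floor_atTop.comp hlog
  have hexp : Tendsto (fun n : ℕ ↦ log (n : ℝ) / log (log n) / (log n - 1)) atTop (𝓝 0) := by
    have h2 : Tendsto (fun n : ℕ ↦ 2 / log (log (n : ℝ))) atTop (𝓝 0) :=
      (tendsto_log_atTop.comp hlog).const_div_atTop 2
    refine squeeze_zero' ?_ ?_ h2
    · filter_upwards [hlog.eventually_gt_atTop 1] with n hn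
      have := log_pos hn
      have : 0 < log (n : ℝ) - 1 := by linarith
      positivity
    · filter_upwards [hlog.eventually_ge_atTop 2] with n hn
      have := log_pos (show 1 < log (n : ℝ) by linarith)
      rw [div_right_comm]
      gcongr
      rw [div_le_iff₀] <;> linarith
  refine ⟨fun n ↦ (∏ p ∈ Nat.primesLE ⌊log (n : ℝ)⌋₊, (1 - 1 / (p : ℝ))⁻¹) /
      log ⌊log (n : ℝ)⌋₊ * (∏ p ∈ Nat.primesLE ⌊log (n : ℝ)⌋₊, localFactor r p) *
      exp (log n / log (log n) / (log n - 1)), ?_, ?_⟩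
  · filter_upwards [hlog.eventually_gt_atTop 1, hfloor.eventually_ge_atTop 2] with n hn hN
    have hN' : 0 < log (⌊log (n : ℝ)⌋₊ : ℝ) := log_pos (by exact_mod_cast hN)
    have hle : log (⌊log (n : ℝ)⌋₊ : ℝ) ≤ log (log n) :=
      log_le_log (by positivity) (Nat.floor_le (by linarith))
    have hprime : ∀ p ∈ Nat.primesLE ⌊log (n : ℝ)⌋₊, p.Prime :=
      fun p hp ↦ (Nat.mem_primesLE.1 hp).2
    calc r n / log (log n) ≤ r n / log (⌊log (n : ℝ)⌋₊ : ℝ) :=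
          div_le_div_of_nonneg_left (hr.nonneg n) hN' hle
      _ ≤ _ := div_le_div_of_nonneg_right (hr.le_prod_mul_exp hn) hN'.le
      _ = _ := by
          rw [← prod_localFactor_mul _ hprime]
          ring
  · have h := (((tendsto_prod_primesLE_inv_div_log.comp hfloor).mul
      ((tendsto_prod_primesLE hm).comp hfloor)).mul ((continuous_exp.tendsto 0).comp hexp))
    simpa using h

theorem map_prod_prime_pow (hr : IsDivisorSumRatio r) (f : ℕ → ℕ) (s : Finset ℕ)
    (hs : ∀ p ∈ s, p.Prime) : r (∏ p ∈ s, p ^ f p) = ∏ p ∈ s, r (p ^ f p) := by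
  induction s using Finset.induction_on with
  | empty => simp [hr.map_one]
  | insert q s hq ih =>
    rw [prod_insert hq, prod_insert hq, hr.map_mul, ih fun p hp ↦ hs p (mem_insert_of_mem hp)]
    refine Nat.Coprime.prod_right fun p hp ↦ Nat.Coprime.pow _ _ ?_
    refine (Nat.coprime_primes (hs q (mem_insert_self _ _)) (hs p (mem_insert_of_mem hp))).2 ?_
    rintro rfl
    exact hq hp

theorem exists_lt_prod (hr : IsDivisorSumRatio r)
    (hm : Multipliable fun p : Nat.Primes ↦ localFactor r p) {c : ℝ}
    (hc : c < exp eulerMascheroniConstant * ∏' p : Nat.Primes, localFactor r p) :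
    ∃ y : ℕ, 1 ≤ y ∧ ∃ ν : ℕ → ℕ, c < exp eulerMascheroniConstant *
      ((∏ p ∈ Nat.primesLE y, (1 - 1 / (p : ℝ)) * r (p ^ ν p)) * (1 - 1 / (y : ℝ))) := by
  have h1 : Tendsto (fun y : ℕ ↦ exp eulerMascheroniConstant *
      ((∏ p ∈ Nat.primesLE y, localFactor r p) * (1 - 1 / (y : ℝ)))) atTop
      (𝓝 (exp eulerMascheroniConstant *
        ((∏' p : Nat.Primes, localFactor r p) * (1 - 0)))) :=
    ((tendsto_prod_primesLE hm).mul
      (tendsto_one_div_atTop_nhds_zero_nat.const_sub 1)).const_mul _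
  rw [sub_zero, mul_one] at h1
  obtain ⟨y, hy, hy1⟩ := ((h1.eventually_const_lt hc).and (eventually_ge_atTop 1)).exists
  have h2 (p : ℕ) : ∃ u : ℕ → ℕ, p.Prime →
      Tendsto (fun k ↦ r (p ^ u k)) atTop (𝓝 (⨆ ν, r (p ^ ν))) := by
    by_cases hp : p.Prime
    · obtain ⟨v, -, hv, hmem⟩ :=
        exists_seq_tendsto_sSup (Set.range_nonempty _) (hr.bddAbove_range hp)
      choose u hu using hmem
      refine ⟨u, fun _ ↦ hv.congr fun k ↦ (hu k).symm⟩
    · exact ⟨id, fun h ↦ absurd h hp⟩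
  choose u hu using h2
  have h3 : Tendsto (fun k ↦ exp eulerMascheroniConstant *
      ((∏ p ∈ Nat.primesLE y, (1 - 1 / (p : ℝ)) * r (p ^ u p k)) * (1 - 1 / (y : ℝ)))) atTop
      (𝓝 (exp eulerMascheroniConstant *
        ((∏ p ∈ Nat.primesLE y, localFactor r p) * (1 - 1 / (y : ℝ))))) :=
    ((tendsto_finsetProd _ fun p hp ↦
      (hu p (Nat.mem_primesLE.1 hp).2).const_mul _).mul_const _).const_mul _
  obtain ⟨k, hk⟩ := (h3.eventually_const_lt hy).exists
  exact ⟨y, hy1, fun p ↦ u p k, hk⟩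

theorem mul_prod_inv_le (hr : IsDivisorSumRatio r) {f : ℕ → ℕ} {x y : ℕ} (hy : 1 ≤ y)
    (hyx : y ≤ x) (hf : ∀ p : ℕ, p.Prime → y < p → 1 + 1 / (p : ℝ) ≤ r (p ^ f p)) :
    (∏ p ∈ Nat.primesLE y, (1 - 1 / (p : ℝ)) * r (p ^ f p)) * (1 - 1 / (y : ℝ)) *
      ∏ p ∈ Nat.primesLE x, (1 - 1 / (p : ℝ))⁻¹ ≤ ∏ p ∈ Nat.primesLE x, r (p ^ f p) := by
  have hprime {z p : ℕ} (hp : p ∈ Nat.primesLE z) : p.Prime := (Nat.mem_primesLE.1 hp).2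
  have hsub : Nat.primesLE y ⊆ Nat.primesLE x := fun p hp ↦
    Nat.mem_primesLE.2 ⟨(Nat.mem_primesLE.1 hp).1.trans hyx, hprime hp⟩
  have hmem {p : ℕ} (hp : p ∈ Nat.primesLE x \ Nat.primesLE y) : p.Prime ∧ y < p ∧ p ≤ x := by
    rw [Finset.mem_sdiff, Nat.mem_primesLE, Nat.mem_primesLE] at hp
    exact ⟨hp.1.2, not_le.1 fun h ↦ hp.2 ⟨h, hp.1.2⟩, hp.1.1⟩
  have hinv : ∏ p ∈ Nat.primesLE x, r (p ^ f p) =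
      (∏ p ∈ Nat.primesLE x, (1 - 1 / (p : ℝ)) * r (p ^ f p)) *
        ∏ p ∈ Nat.primesLE x, (1 - 1 / (p : ℝ))⁻¹ := by
    rw [← prod_mul_distrib]
    refine prod_congr rfl fun p hp ↦ ?_
    rw [mul_right_comm, mul_inv_cancel₀ (one_sub_inv_pos (hprime hp)).ne', one_mul]
  have hsum : ∑ p ∈ Nat.primesLE x \ Nat.primesLE y, 1 / (p : ℝ) ^ 2 ≤ 1 / (y : ℝ) := by
    calc ∑ p ∈ Nat.primesLE x \ Nat.primesLE y, 1 / (p : ℝ) ^ 2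
        ≤ ∑ p ∈ Ioc y x, ((p : ℝ) ^ 2)⁻¹ := by
          simp only [one_div]
          exact sum_le_sum_of_subset_of_nonneg
            (fun p hp ↦ mem_Ioc.2 (hmem hp).2) fun _ _ _ ↦ by positivity
      _ ≤ (y : ℝ)⁻¹ - (x : ℝ)⁻¹ := sum_Ioc_inv_sq_le_sub (by lia) hyx
      _ ≤ 1 / (y : ℝ) := by
          rw [one_div, sub_le_self_iff]
          positivity
  have htail : 1 - 1 / (y : ℝ) ≤
      ∏ p ∈ Nat.primesLE x \ Nat.primesLE y, (1 - 1 / (p : ℝ)) * r (p ^ f p) := by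
    have hle1 : ∀ p ∈ Nat.primesLE x \ Nat.primesLE y, 1 / (p : ℝ) ^ 2 ≤ 1 := fun p hp ↦ by
      have : (1 : ℝ) ≤ p := by exact_mod_cast (hmem hp).1.one_le
      rw [div_le_one (by positivity)]
      exact one_le_pow₀ this
    calc 1 - 1 / (y : ℝ) ≤ 1 - ∑ p ∈ Nat.primesLE x \ Nat.primesLE y, 1 / (p : ℝ) ^ 2 := by
          linarith
      _ ≤ ∏ p ∈ Nat.primesLE x \ Nat.primesLE y, (1 - 1 / (p : ℝ) ^ 2) :=
          one_sub_sum_le_prod_one_sub _ _ (fun _ _ ↦ by positivity) hle1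
      _ ≤ _ := by
          refine prod_le_prod (fun p hp ↦ sub_nonneg.2 (hle1 p hp)) fun p hp ↦ ?_
          calc 1 - 1 / (p : ℝ) ^ 2 = (1 - 1 / (p : ℝ)) * (1 + 1 / (p : ℝ)) := by ring
            _ ≤ _ := mul_le_mul_of_nonneg_left (hf p (hmem hp).1 (hmem hp).2.1)
              (one_sub_inv_pos (hmem hp).1).le
  rw [hinv, ← prod_sdiff (f := fun p : ℕ ↦ (1 - 1 / (p : ℝ)) * r (p ^ f p)) hsub,
    mul_comm (∏ p ∈ _ \ _, _)]
  refine mul_le_mul_of_nonneg_right (mul_le_mul_of_nonneg_left htail ?_) ?_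
  · exact prod_nonneg fun p hp ↦ mul_nonneg (one_sub_inv_pos (hprime hp)).le (hr.nonneg _)
  · exact prod_nonneg fun p hp ↦ (inv_pos.2 (one_sub_inv_pos (hprime hp))).le

theorem exists_forall_le_mul_rpow {e f : ℕ → ℕ} {y : ℕ} (he_pos : ∀ p : ℕ, p.Prime → 0 < e p)
    (he : Tendsto (fun p : ℕ ↦ log (e p) / log p) (atTop ⊓ 𝓟 {p : ℕ | p.Prime}) (𝓝 0))
    (hf : ∀ p, y < p → f p = e p) {η : ℝ} (hη : 0 < η) :
    ∃ C : ℝ, 0 < C ∧ ∀ p : ℕ, p.Prime → f p ≤ C * (p : ℝ) ^ η := by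
  obtain ⟨p₀, hp₀⟩ := eventually_atTop.1
    (eventually_inf_principal.1 (he.eventually_lt_const hη))
  refine ⟨1 + ∑ p ∈ range (p₀ + y + 1), (f p : ℝ), by positivity, fun p hp ↦ ?_⟩
  have hp1 : (1 : ℝ) < p := by exact_mod_cast hp.one_lt
  have hpη : 1 ≤ (p : ℝ) ^ η := one_le_rpow hp1.le hη.le
  have hsum : 0 ≤ ∑ p ∈ range (p₀ + y + 1), (f p : ℝ) := by positivity
  by_cases hpy : p < p₀ + y + 1
  · have hle : (f p : ℝ) ≤ ∑ p ∈ range (p₀ + y + 1), (f p : ℝ) :=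
      single_le_sum (f := fun p ↦ (f p : ℝ)) (fun _ _ ↦ by positivity) (mem_range.2 hpy)
    nlinarith
  · have hlog := (div_lt_iff₀ (log_pos hp1)).1 (hp₀ p (by lia) hp)
    have hpow : (e p : ℝ) ≤ (p : ℝ) ^ η := by
      rw [← log_le_log_iff (Nat.cast_pos.2 (he_pos p hp)) (by positivity),
        log_rpow (by linarith)]
      exact hlog.le
    rw [hf p (by lia)]
    nlinarith

theorem log_prod_prime_pow_le {f : ℕ → ℕ} {C η : ℝ} (hC : 0 < C) (hη : 0 < η)
    (hf : ∀ p : ℕ, p.Prime → f p ≤ C * (p : ℝ) ^ η) (x : ℕ) :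
    log ((∏ p ∈ Nat.primesLE x, p ^ f p : ℕ) : ℝ) ≤ C * x ^ η * (log 4 * x) := by
  calc log ((∏ p ∈ Nat.primesLE x, p ^ f p : ℕ) : ℝ)
      = ∑ p ∈ Nat.primesLE x, f p * log (p : ℝ) := by
        push_cast
        rw [log_prod fun p hp ↦
          pow_ne_zero _ (Nat.cast_ne_zero.2 (Nat.mem_primesLE.1 hp).2.ne_zero)]
        simp only [log_pow]
    _ ≤ ∑ p ∈ Nat.primesLE x, C * (x : ℝ) ^ η * log (p : ℝ) := by
        gcongr with p hp
        obtain ⟨hpx, hp⟩ := Nat.mem_primesLE.1 hp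
        refine (hf p hp).trans ?_
        gcongr
    _ = C * x ^ η * Chebyshev.theta x := by
        rw [Chebyshev.theta_eq_sum_primesLE_log, mul_sum]
    _ ≤ _ := by
        gcongr
        exact Chebyshev.theta_le_log4_mul_x (by positivity)

theorem frequently_le (hr : IsDivisorSumRatio r)
    (hm : Multipliable fun p : Nat.Primes ↦ localFactor r p) {e : ℕ → ℕ}
    (he_pos : ∀ p : ℕ, p.Prime → 0 < e p)
    (he : Tendsto (fun p : ℕ ↦ log (e p) / log p) (atTop ⊓ 𝓟 {p : ℕ | p.Prime}) (𝓝 0))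
    (hre : ∀ p : ℕ, p.Prime → 1 + 1 / (p : ℝ) ≤ r (p ^ e p)) {c : ℝ}
    (hc : c < exp eulerMascheroniConstant * ∏' p : Nat.Primes, localFactor r p) :
    ∃ᶠ n : ℕ in atTop, c ≤ r n / log (log n) := by
  obtain ⟨y, hy, ν, hc⟩ := hr.exists_lt_prod hm hc
  set f : ℕ → ℕ := fun p ↦ if p ≤ y then ν p else e p with hf
  set κ := (∏ p ∈ Nat.primesLE y, (1 - 1 / (p : ℝ)) * r (p ^ ν p)) * (1 - 1 / (y : ℝ)) with hκ
  have hfe (p : ℕ) (hp : y < p) : f p = e p := if_neg hp.not_ge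
  have hκf : κ = (∏ p ∈ Nat.primesLE y, (1 - 1 / (p : ℝ)) * r (p ^ f p)) *
      (1 - 1 / (y : ℝ)) := by
    rw [hκ]
    congr 1
    refine prod_congr rfl fun p hp ↦ ?_
    rw [hf]
    simp only [if_pos (Nat.mem_primesLE.1 hp).1]
  -- choose the loss `η` in the exponent of `x`
  have hηlim : Tendsto (fun η : ℝ ↦ exp eulerMascheroniConstant * κ / (1 + η)) (𝓝[>] 0)
      (𝓝 (exp eulerMascheroniConstant * κ / (1 + 0))) :=
    (tendsto_const_nhds.div (tendsto_id.const_add 1) (by norm_num)).mono_left nhdsWithin_le_nhds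
  rw [add_zero, div_one] at hηlim
  obtain ⟨η, hηc, hη : 0 < η⟩ :=
    ((hηlim.eventually_const_lt hc).and self_mem_nhdsWithin).exists
  obtain ⟨C, hC, hCf⟩ := exists_forall_le_mul_rpow he_pos he hfe hη
  set n : ℕ → ℕ := fun x ↦ ∏ p ∈ Nat.primesLE x, p ^ f p with hn
  have hntop : Tendsto n atTop atTop := by
    refine tendsto_atTop.2 fun b ↦ ?_
    obtain ⟨p, hbp, hp⟩ := Nat.exists_infinite_primes (b + y + 1)
    filter_upwards [eventually_ge_atTop p] with x hx
    have hpos : 0 < n x := prod_pos fun q hq ↦ pow_pos (Nat.mem_primesLE.1 hq).2.pos _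
    have hdvd : p ∣ n x := (dvd_pow_self p (by
      rw [hfe p (by lia)]
      exact (he_pos p hp).ne')).trans
        (dvd_prod_of_mem (fun p ↦ p ^ f p) (Nat.mem_primesLE.2 ⟨hx, hp⟩))
    have := Nat.le_of_dvd hpos hdvd
    lia
  have hlog : Tendsto (fun x : ℕ ↦ log (x : ℝ)) atTop atTop :=
    tendsto_log_atTop.comp tendsto_natCast_atTop_atTop
  have hlim : Tendsto (fun x : ℕ ↦ κ * (∏ p ∈ Nat.primesLE x, (1 - 1 / (p : ℝ))⁻¹) /
      (log (C * log 4) + (1 + η) * log x)) atTop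
      (𝓝 (exp eulerMascheroniConstant * κ / (1 + η))) := by
    have hden : Tendsto (fun x : ℕ ↦ log (C * log 4) / log (x : ℝ) + (1 + η)) atTop
        (𝓝 (0 + (1 + η))) := (hlog.const_div_atTop _).add_const _
    rw [zero_add] at hden
    have h := (tendsto_prod_primesLE_inv_div_log.mul_const κ).div hden (by positivity)
    refine h.congr' ?_
    filter_upwards [hlog.eventually_gt_atTop 0] with x hx
    rw [Pi.div_apply, div_add' _ _ _ hx.ne', mul_comm _ κ, ← mul_div_assoc,
      div_div_div_cancel_right₀ hx.ne']
  refine hntop.frequently (Eventually.frequently ?_)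
  filter_upwards [hlim.eventually_const_lt hηc, eventually_ge_atTop y, eventually_ge_atTop 1,
    ((tendsto_log_atTop.comp hlog).comp hntop).eventually_gt_atTop 0,
    (hlog.comp hntop).eventually_gt_atTop 0] with x hcx hyx hx1 hloglog hlogn
  simp only [Function.comp_apply] at hloglog hlogn
  have hx0 : (0 : ℝ) < x := by exact_mod_cast hx1
  have hle : log (log (n x : ℝ)) ≤ log (C * log 4) + (1 + η) * log x := by
    have h4 : 0 < log (4 : ℝ) := log_pos (by norm_num)
    calc log (log (n x : ℝ)) ≤ log (C * x ^ η * (log 4 * x)) :=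
          log_le_log hlogn (log_prod_prime_pow_le hC hη hCf x)
      _ = log (C * log 4) + (1 + η) * log x := by
          rw [log_mul (by positivity) (by positivity), log_mul (by positivity) (by positivity),
            log_mul (by positivity) (by positivity), log_mul (by positivity) (by positivity),
            log_rpow hx0]
          ring
  have hrn : κ * ∏ p ∈ Nat.primesLE x, (1 - 1 / (p : ℝ))⁻¹ ≤ r (n x) := by
    rw [hn, hr.map_prod_prime_pow f _ fun p hp ↦ (Nat.mem_primesLE.1 hp).2, hκf]
    refine hr.mul_prod_inv_le hy hyx fun p hp hyp ↦ ?_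
    rw [hfe p hyp]
    exact hre p hp
  calc c ≤ _ := hcx.le
    _ ≤ r (n x) / (log (C * log 4) + (1 + η) * log x) :=
        div_le_div_of_nonneg_right hrn (hloglog.le.trans hle)
    _ ≤ r (n x) / log (log (n x)) := div_le_div_of_nonneg_left (hr.nonneg _) hloglog hle

theorem limsup_eq (hr : IsDivisorSumRatio r)
    (hm : Multipliable fun p : Nat.Primes ↦ localFactor r p) {e : ℕ → ℕ}
    (he_pos : ∀ p : ℕ, p.Prime → 0 < e p)
    (he : Tendsto (fun p : ℕ ↦ log (e p) / log p) (atTop ⊓ 𝓟 {p : ℕ | p.Prime}) (𝓝 0))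
    (hre : ∀ p : ℕ, p.Prime → 1 + 1 / (p : ℝ) ≤ r (p ^ e p)) :
    limsup (fun n : ℕ ↦ r n / log (log n)) atTop =
      exp eulerMascheroniConstant * ∏' p : Nat.Primes, localFactor r p := by
  obtain ⟨u, hu, hulim⟩ := hr.exists_tendsto_of_eventually_le hm
  have hbdd : IsBoundedUnder (· ≤ ·) atTop fun n : ℕ ↦ r n / log (log n) :=
    hulim.isBoundedUnder_le.mono_le hu
  have hcobdd : IsCoboundedUnder (· ≤ ·) atTop fun n : ℕ ↦ r n / log (log n) := by
    refine IsBoundedUnder.isCoboundedUnder_le (isBoundedUnder_of_eventually_ge (a := 0) ?_)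
    have hlog : Tendsto (fun n : ℕ ↦ log (log (n : ℝ))) atTop atTop :=
      tendsto_log_atTop.comp (tendsto_log_atTop.comp tendsto_natCast_atTop_atTop)
    filter_upwards [hlog.eventually_ge_atTop 0] with n hn
    exact div_nonneg (hr.nonneg n) hn
  refine le_antisymm ?_ (le_of_forall_lt_imp_le_of_dense fun c hc ↦
    le_limsup_of_frequently_le (hr.frequently_le hm he_pos he hre hc) hbdd)
  exact (limsup_le_limsup hu hcobdd hulim.isBoundedUnder_le).trans_eq hulim.limsup_eq

end IsDivisorSumRatio
end MultiplicativeRatio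

section DivisorSystem
open Finset

theorem sum_mul_of_coprime {m n : ℕ} (hm : 1 ≤ m) (hmn : m.Coprime n) {s t : Finset ℕ}
    (hs : ∀ d ∈ s, d ∣ m) (ht : ∀ d ∈ t, d ∣ n) :
    ∑ d ∈ s * t, (d : ℝ) = (∑ d ∈ s, (d : ℝ)) * ∑ d ∈ t, (d : ℝ) := by
  have key {a b a' b' : ℕ} (ha : a ∈ s) (hb' : b' ∈ t) (h : a * b = a' * b') : a ∣ a' :=
    ((hmn.coprime_dvd_left (hs a ha)).coprime_dvd_right (ht b' hb')).dvd_of_dvd_mul_right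
      (h ▸ dvd_mul_right a b)
  rw [Finset.mul_def, sum_image, sum_product, sum_mul_sum]
  · simp
  · rintro ⟨a, b⟩ hab ⟨a', b'⟩ hab' h
    simp only [coe_product, Set.mem_prod, mem_coe] at hab hab' h
    obtain rfl := Nat.dvd_antisymm (key hab.1 hab'.2 h) (key hab'.1 hab.2 h.symm)
    rw [Nat.eq_of_mul_eq_mul_left (Nat.pos_of_dvd_of_pos (hs a hab.1) hm) h]

theorem sum_prime_pow_div_le {p : ℕ} (hp : p.Prime) (ν : ℕ) {s : Finset ℕ}
    (hs : ∀ d ∈ s, d ∣ p ^ ν) :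
    (∑ d ∈ s, (d : ℝ)) / (p ^ ν : ℕ) ≤ (1 - 1 / (p : ℝ))⁻¹ := by
  have hp1 : (1 : ℝ) < p := by exact_mod_cast hp.one_lt
  have hsum : ∑ d ∈ s, (d : ℝ) ≤ ∑ k ∈ range (ν + 1), (p : ℝ) ^ k := by
    calc ∑ d ∈ s, (d : ℝ) ≤ ∑ d ∈ (p ^ ν).divisors, (d : ℝ) :=
          sum_le_sum_of_subset_of_nonneg
            (fun d hd ↦ Nat.mem_divisors.2 ⟨hs d hd, pow_ne_zero _ hp.ne_zero⟩)
            fun _ _ _ ↦ by positivity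
      _ = _ := by
          rw [Nat.sum_divisors_prime_pow hp]
          push_cast
          rfl
  have hgeom : (∑ k ∈ range (ν + 1), (p : ℝ) ^ k) * (p - 1) ≤ p ^ ν * p := by
    rw [geom_sum_mul, pow_succ]
    linarith
  have hinv : (1 - 1 / (p : ℝ))⁻¹ = p / (p - 1) := by
    have : (p : ℝ) - 1 ≠ 0 := by linarith
    field_simp
  rw [hinv, Nat.cast_pow, div_le_div_iff₀ (by positivity) (by linarith), mul_comm (p : ℝ)]
  exact (mul_le_mul_of_nonneg_right hsum (by linarith)).trans hgeom

theorem isDivisorSumRatio_of_multiplicative {A : ℕ → Finset ℕ}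
    (hdvd : ∀ n : ℕ, 1 ≤ n → ∀ d ∈ A n, d ∣ n)
    (hmul : ∀ m n : ℕ, 1 ≤ m → 1 ≤ n → Nat.Coprime m n → A (m * n) = A m * A n)
    (hne : ∃ n : ℕ, 1 ≤ n ∧ (A n).Nonempty) :
    IsDivisorSumRatio fun n ↦ (∑ d ∈ A n, (d : ℝ)) / n where
  nonneg n := by positivity
  map_one := by
    obtain ⟨n, hn, hA⟩ := hne
    have h := hmul n 1 hn le_rfl (Nat.coprime_one_right n)
    rw [mul_one] at h
    have hA1 : (A 1).Nonempty := by
      rw [h] at hA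
      exact hA.of_mul_right
    have : A 1 = {1} :=
      hA1.subset_singleton_iff.1 fun d hd ↦ mem_singleton.2 (Nat.dvd_one.1 (hdvd 1 le_rfl d hd))
    simp [this]
  map_mul m n hmn := by
    rcases Nat.eq_zero_or_pos m with rfl | hm
    · simp
    rcases Nat.eq_zero_or_pos n with rfl | hn
    · simp
    rw [hmul m n hm hn hmn, sum_mul_of_coprime hm hmn (hdvd m hm) (hdvd n hn), Nat.cast_mul,
      mul_div_mul_comm]
  map_prime_pow_le p ν hp := sum_prime_pow_div_le hp ν (hdvd _ (Nat.pow_pos hp.pos))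

theorem one_add_one_div_le_sum_div {p k : ℕ} (hp : p.Prime) (hk : 0 < k) {s : Finset ℕ}
    (h1 : p ^ k ∈ s) (h2 : p ^ (k - 1) ∈ s) :
    1 + 1 / (p : ℝ) ≤ (∑ d ∈ s, (d : ℝ)) / (p ^ k : ℕ) := by
  have hp0 : (0 : ℝ) < p := by exact_mod_cast hp.pos
  have hne : p ^ k ≠ p ^ (k - 1) := (Nat.pow_lt_pow_right hp.one_lt (by lia)).ne'
  have hle : ∑ d ∈ {p ^ k, p ^ (k - 1)}, (d : ℝ) ≤ ∑ d ∈ s, (d : ℝ) :=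
    sum_le_sum_of_subset_of_nonneg (by simp [insert_subset_iff, h1, h2])
      fun _ _ _ ↦ by positivity
  rw [sum_pair hne] at hle
  rw [le_div_iff₀ (Nat.cast_pos.2 (Nat.pow_pos hp.pos))]
  refine le_trans (le_of_eq ?_) hle
  obtain ⟨j, rfl⟩ := Nat.exists_eq_succ_of_ne_zero hk.ne'
  push_cast [Nat.succ_sub_one, Nat.succ_eq_add_one]
  field_simp
  ring

end DivisorSystem

/-- **Theorem 6 (Tóth–Wirsing).** Let `A` be a multiplicative divisor system such
that for each prime `p` there is an exponent `e p = p^{o(1)}` with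
`p^{e p}, p^{e p - 1} ∈ A (p^{e p})`.  Then, with `σ_A(n) = ∑_{d ∈ A(n)} d`,
`limsup σ_A(n)/(n log log n) = e^γ ∏_p (1 - 1/p) sup_ν σ_A(p^ν)/p^ν`,
and the product converges. -/
theorem limsup_sigmaA_eq
    (A : ℕ → Finset ℕ)
    (hdvd : ∀ n : ℕ, 1 ≤ n → ∀ d ∈ A n, d ∣ n)
    (hmul : ∀ m n : ℕ, 1 ≤ m → 1 ≤ n → Nat.Coprime m n → A (m * n) = A m * A n)
    (hne : ∃ n : ℕ, 1 ≤ n ∧ (A n).Nonempty)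
    (e : ℕ → ℕ) (he_pos : ∀ p : ℕ, p.Prime → 0 < e p)
    (hmem : ∀ p : ℕ, p.Prime → p ^ e p ∈ A (p ^ e p) ∧ p ^ (e p - 1) ∈ A (p ^ e p))
    (he : Filter.Tendsto (fun p : ℕ => Real.log (e p) / Real.log p)
      (Filter.atTop ⊓ Filter.principal {p : ℕ | p.Prime}) (nhds 0)) :
    Multipliable (fun p : Nat.Primes => (1 - 1 / ((p : ℕ) : ℝ)) *
      ⨆ ν : ℕ, (∑ d ∈ A ((p : ℕ) ^ ν), (d : ℝ)) / ((p : ℕ) : ℝ) ^ ν) ∧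
    Filter.limsup
      (fun n : ℕ => (∑ d ∈ A n, (d : ℝ)) / (n * Real.log (Real.log n)))
      Filter.atTop =
      Real.exp Real.eulerMascheroniConstant *
        ∏' p : Nat.Primes, ((1 - 1 / ((p : ℕ) : ℝ)) *
          ⨆ ν : ℕ, (∑ d ∈ A ((p : ℕ) ^ ν), (d : ℝ)) / ((p : ℕ) : ℝ) ^ ν) := by
  have hr := isDivisorSumRatio_of_multiplicative hdvd hmul hne
  have hre (p : ℕ) (hp : p.Prime) :=
    one_add_one_div_le_sum_div hp (he_pos p hp) (hmem p hp).1 (hmem p hp).2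
  have hm := hr.multipliable_localFactor hre
  have hlim := hr.limsup_eq hm he_pos he hre
  simp only [IsDivisorSumRatio.localFactor, Nat.cast_pow, div_div] at hm hlim
  exact ⟨hm, hlim⟩
end
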